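/- As n → ∞, q_{1/3}(n) ~ ((5/14)^{1/2} · e^{6075ζ(3)³/(49π⁸) − 15ζ(3)/(28π²)} / (2^{11/4}·(5n/14)^{5/8})) · exp( (28π/15)·(5n/14)^{3/4} + (9ζ(3)/π²)·(5n/14)^{1/2} + ((7π⁶ − 1215ζ(3)²)/(42π⁵))·(5n/14)^{1/4} ). -/

import Mathlib

open Filter Topology Real

/-- The Piatetski-Shapiro part: `⌊ℓ^κ⌋`. -/
noncomputable def psPart (κ : ℝ) (ℓ : ℕ) : ℕ := ⌊(ℓ : ℝ) ^ κ⌋₊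

/-- `q_κ(n)`: number of partitions of `n` into distinct parts from `(⌊ℓ^κ⌋)_{ℓ ≥ 1}`. -/
noncomputable def qk (κ : ℝ) (n : ℕ) : ℕ :=
  Nat.card {r : ℕ →₀ ℕ // (∀ ℓ, r ℓ ≤ 1) ∧ (r.sum fun ℓ j => j * psPart κ (ℓ + 1)) = n}

/-- Riemann zeta at a real argument (real-valued there). -/
noncomputable def realZeta (x : ℝ) : ℝ := (riemannZeta (x : ℂ)).re

/-! ### The coefficient integral -/

/-- `mult j = (j + 2) ^ 3 - (j + 1) ^ 3` is the multiplicity of the part `j + 1` in the sequence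
`⌊ℓ ^ (1 / 3)⌋`. -/
def mult (j : ℕ) : ℕ := 3 * (j + 1) ^ 2 + 3 * (j + 1) + 1

theorem card_distinct_eq (a : ℕ → ℕ) (n L : ℕ) (hL : ∀ ℓ, L ≤ ℓ → n < a ℓ) :
    Nat.card {r : ℕ →₀ ℕ // (∀ ℓ, r ℓ ≤ 1) ∧ (r.sum fun ℓ j => j * a ℓ) = n} =
      (((Finset.range L).powerset).filter fun s => ∑ ℓ ∈ s, a ℓ = n).card := by
  classical
  rw [← Fintype.card_coe, ← Nat.card_eq_fintype_card]
  have hsum : ∀ r : ℕ →₀ ℕ, (∀ ℓ, r ℓ ≤ 1) → (r.sum fun ℓ j => j * a ℓ) = ∑ ℓ ∈ r.support, a ℓ := by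
    intro r hr
    refine Finset.sum_congr rfl fun ℓ hℓ => ?_
    have := hr ℓ
    have h0 := Finsupp.mem_support_iff.1 hℓ
    have : r ℓ = 1 := by omega
    simp [this]
  refine Nat.card_eq_of_bijective (fun r => ⟨r.1.support, ?_⟩) ⟨?_, ?_⟩
  · obtain ⟨r, h1, h2⟩ := r
    rw [hsum r h1] at h2
    simp only [Finset.mem_filter, Finset.mem_powerset]
    refine ⟨fun ℓ hℓ => ?_, h2⟩
    by_contra hc
    have h3 := hL ℓ (by simpa using hc)
    have h4 := Finset.single_le_sum (f := a) (fun _ _ => Nat.zero_le _) hℓ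
    omega
  · rintro ⟨r, h1, h2⟩ ⟨r', h1', h2'⟩ h
    have hs : r.support = r'.support := by simpa using h
    refine Subtype.ext (Finsupp.ext fun ℓ => ?_)
    have h3 := h1 ℓ
    have h4 := h1' ℓ
    have h5 : r ℓ ≠ 0 ↔ r' ℓ ≠ 0 := by
      rw [← Finsupp.mem_support_iff, ← Finsupp.mem_support_iff, hs]
    show r ℓ = r' ℓ
    omega
  · rintro ⟨s, hs⟩
    simp only [Finset.mem_filter, Finset.mem_powerset] at hs
    let r : ℕ →₀ ℕ := Finsupp.onFinset s (fun ℓ => if ℓ ∈ s then 1 else 0) (by intro ℓ; simp)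
    have hr : r.support = s := by
      ext ℓ
      simp [r]
    have hr1 : ∀ ℓ, r ℓ ≤ 1 := by
      intro ℓ
      simp only [r, Finsupp.onFinset_apply]
      split_ifs <;> simp
    exact ⟨⟨r, hr1, by rw [hsum r hr1, hr]; exact hs.2⟩, Subtype.ext hr⟩

theorem integral_exp_int_mul (m : ℤ) :
    ∫ θ in (-π)..π, Complex.exp (m * (θ : ℂ) * Complex.I) = if m = 0 then 2 * (π : ℂ) else 0 := by
  split_ifs with h
  · subst h
    simp
    ring
  · have hc : (m : ℂ) * Complex.I ≠ 0 := by simp [h]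
    have h1 := integral_exp_mul_complex (a := -π) (b := π) hc
    have h2 : ∀ θ : ℝ, (m : ℂ) * (θ : ℂ) * Complex.I = (m : ℂ) * Complex.I * θ := fun θ => by ring
    simp_rw [h2, h1]
    have h3 : Complex.exp ((m : ℂ) * Complex.I * (π : ℝ)) =
        Complex.exp ((m : ℂ) * Complex.I * ((-π : ℝ) : ℂ)) := by
      rw [Complex.exp_eq_exp_iff_exists_int]
      exact ⟨m, by push_cast; ring⟩
    rw [h3, sub_self, zero_div]

theorem card_distinct_eq_integral (a : ℕ → ℕ) (n L : ℕ) (hL : ∀ ℓ, L ≤ ℓ → n < a ℓ) (t : ℝ) :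
    (2 * π : ℂ) * (Nat.card {r : ℕ →₀ ℕ // (∀ ℓ, r ℓ ≤ 1) ∧ (r.sum fun ℓ j => j * a ℓ) = n} : ℂ) =
      Complex.exp (n * t) * ∫ θ in (-π)..π, Complex.exp (-(n * θ * Complex.I)) *
        ∏ ℓ ∈ Finset.range L, (1 + Complex.exp (a ℓ * (-t + θ * Complex.I))) := by
  classical
  rw [card_distinct_eq a n L hL]
  have h1 : ∀ θ : ℝ, Complex.exp (-(n * θ * Complex.I)) *
      ∏ ℓ ∈ Finset.range L, (1 + Complex.exp (a ℓ * (-t + θ * Complex.I))) =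
      ∑ s ∈ (Finset.range L).powerset, Complex.exp (-((∑ ℓ ∈ s, a ℓ : ℕ) * t)) *
        Complex.exp ((((∑ ℓ ∈ s, a ℓ : ℕ) : ℤ) - (n : ℤ) : ℤ) * (θ : ℂ) * Complex.I) := by
    intro θ
    rw [Finset.prod_one_add, Finset.mul_sum]
    refine Finset.sum_congr rfl fun s _ => ?_
    rw [← Complex.exp_sum, ← Finset.sum_mul, ← Complex.exp_add, ← Complex.exp_add]
    congr 1
    push_cast
    ring
  simp_rw [h1]
  rw [intervalIntegral.integral_finsetSum]
  · simp_rw [intervalIntegral.integral_const_mul, integral_exp_int_mul, Finset.mul_sum]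
    rw [Finset.card_eq_sum_ones, Nat.cast_sum, Finset.sum_filter, Finset.mul_sum]
    refine Finset.sum_congr rfl fun s _ => ?_
    by_cases h : ∑ ℓ ∈ s, a ℓ = n
    · rw [if_pos h, if_pos (by rw [h]; simp), h, ← mul_assoc, ← Complex.exp_add]
      simp
    · rw [if_neg h, if_neg (by rw [sub_eq_zero]; exact_mod_cast h)]
      simp
  · intro s _
    exact (by fun_prop : Continuous _).intervalIntegrable _ _

theorem psPart_eq {k ℓ : ℕ} (h1 : k ^ 3 ≤ ℓ) (h2 : ℓ < (k + 1) ^ 3) : psPart (1 / 3) ℓ = k := by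
  have h0 : ∀ m : ℕ, (m : ℝ) = ((m : ℝ) ^ 3) ^ (1 / 3 : ℝ) := by
    intro m
    rw [← Real.rpow_natCast, ← Real.rpow_mul (by positivity)]
    norm_num
  rw [psPart, Nat.floor_eq_iff (by positivity)]
  constructor
  · rw [h0 k]
    exact Real.rpow_le_rpow (by positivity) (by exact_mod_cast h1) (by norm_num)
  · have := h0 (k + 1)
    push_cast at this
    rw [this]
    exact Real.rpow_lt_rpow (by positivity) (by exact_mod_cast h2) (by norm_num)

theorem le_psPart {k ℓ : ℕ} (h1 : k ^ 3 ≤ ℓ) : k ≤ psPart (1 / 3) ℓ := by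
  have h0 : (k : ℝ) = ((k : ℝ) ^ 3) ^ (1 / 3 : ℝ) := by
    rw [← Real.rpow_natCast, ← Real.rpow_mul (by positivity)]
    norm_num
  rw [psPart, Nat.le_floor_iff (by positivity), h0]
  exact Real.rpow_le_rpow (by positivity) (by exact_mod_cast h1) (by norm_num)

theorem prod_psPart {M : Type*} [CommMonoid M] (g : ℕ → M) (N : ℕ) :
    ∏ ℓ ∈ Finset.range ((N + 1) ^ 3 - 1), g (psPart (1 / 3) (ℓ + 1)) =
      ∏ j ∈ Finset.range N, g (j + 1) ^ mult j := by
  induction N with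
  | zero => simp
  | succ N ih =>
    have h1 : (N + 1 + 1) ^ 3 - 1 = ((N + 1) ^ 3 - 1) + mult N := by
      have : 1 ≤ (N + 1) ^ 3 := Nat.one_le_pow _ _ (by omega)
      have h : (N + 1 + 1) ^ 3 = (N + 1) ^ 3 + mult N := by
        rw [mult]
        ring
      omega
    rw [h1, Finset.prod_range_add, ih, Finset.prod_range_succ]
    congr 1
    rw [Finset.prod_eq_pow_card (b := g (N + 1))]
    · simp
    · intro i hi
      have h2 := Finset.mem_range.1 hi
      have : 1 ≤ (N + 1) ^ 3 := Nat.one_le_pow _ _ (by omega)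
      have h : (N + 1 + 1) ^ 3 = (N + 1) ^ 3 + mult N := by
        rw [mult]
        ring
      rw [psPart_eq (k := N + 1) (by omega) (by omega)]

theorem qk_eq_integral (n N : ℕ) (hN : n ≤ N) (t : ℝ) :
    (2 * π : ℂ) * (qk (1 / 3) n : ℂ) =
      Complex.exp (n * t) * ∫ θ in (-π)..π, Complex.exp (-(n * θ * Complex.I)) *
        ∏ j ∈ Finset.range N,
          (1 + Complex.exp (((j : ℂ) + 1) * (-t + θ * Complex.I))) ^ mult j := by
  rw [qk, card_distinct_eq_integral (fun ℓ => psPart (1 / 3) (ℓ + 1)) n ((N + 1) ^ 3 - 1) _ t]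
  · congr 2
    ext θ
    congr 1
    rw [prod_psPart fun k => 1 + Complex.exp ((k : ℂ) * (-t + θ * Complex.I))]
    push_cast
    rfl
  · intro ℓ hℓ
    have : N + 1 ≤ psPart (1 / 3) (ℓ + 1) := le_psPart (by omega)
    omega

/-! ### Convex sums over the parts -/

/-- The occupation probability `1 / (eˣ + 1)`. -/
noncomputable def fermi (x : ℝ) : ℝ := 1 / (exp x + 1)

/-- The logarithm of the generating function at `e ^ (-t)`. -/
noncomputable def logSum (t : ℝ) : ℝ := ∑' j : ℕ, (mult j : ℝ) * log (1 + exp (-((j + 1) * t)))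

/-- The mean of the random partition with parameter `e ^ (-t)`. -/
noncomputable def meanSum (t : ℝ) : ℝ := ∑' j : ℕ, (mult j : ℝ) * ((j + 1) * fermi ((j + 1) * t))

/-- The variance of the random partition with parameter `e ^ (-t)`. -/
noncomputable def varSum (t : ℝ) : ℝ :=
  ∑' j : ℕ, (mult j : ℝ) * ((j + 1) ^ 2 * (fermi ((j + 1) * t) * (1 - fermi ((j + 1) * t))))

theorem fermi_pos (x : ℝ) : 0 < fermi x := by
  rw [fermi]
  positivity

theorem fermi_lt_one (x : ℝ) : fermi x < 1 := by
  have := exp_pos x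
  rw [fermi, div_lt_one (by positivity)]
  linarith

theorem fermi_le_exp_neg (x : ℝ) : fermi x ≤ exp (-x) := by
  have := exp_pos x
  rw [fermi, exp_neg, ← one_div]
  gcongr
  linarith

theorem one_sub_fermi (x : ℝ) : 1 - fermi x = 1 / (1 + exp (-x)) := by
  have := exp_pos x
  rw [fermi, exp_neg]
  field_simp
  ring

theorem fermi_eq (x : ℝ) : fermi x = exp (-x) / (1 + exp (-x)) := by
  have := exp_pos x
  rw [fermi, exp_neg]
  field_simp

theorem log_one_add_exp_neg_sub_le (x y : ℝ) :
    log (1 + exp (-x)) - fermi x * (y - x) ≤ log (1 + exp (-y)) := by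
  have h1 : exp (-(fermi x * (y - x))) ≤ (1 - fermi x) + fermi x * exp (-(y - x)) := by
    have := convexOn_exp.2 (Set.mem_univ 0) (Set.mem_univ (-(y - x)))
      (sub_nonneg.2 (fermi_lt_one x).le) (fermi_pos x).le (by ring)
    simpa only [smul_eq_mul, mul_zero, zero_add, exp_zero, mul_one, mul_neg] using this
  have h2 : (1 - fermi x) + fermi x * exp (-(y - x)) = (1 + exp (-y)) / (1 + exp (-x)) := by
    rw [one_sub_fermi, fermi_eq, neg_sub, sub_eq_add_neg, exp_add, exp_neg x]
    have := exp_pos x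
    field_simp
  have h3 := (le_log_iff_exp_le (by positivity)).2 (h1.trans_eq h2)
  rw [log_div (by positivity) (by positivity)] at h3
  linarith

theorem hasDerivAt_fermi (x : ℝ) : HasDerivAt fermi (-(fermi x * (1 - fermi x))) x := by
  have h := ((hasDerivAt_exp x).add_const 1).inv (by positivity)
  have h1 : fermi = (fun y => exp y + 1)⁻¹ := by
    ext y
    simp [fermi]
  rw [← h1] at h
  refine h.congr_deriv ?_
  have := exp_pos x
  rw [fermi]
  field_simp
  ring

theorem fermi_sub_le {x y : ℝ} (hx : 0 < x) (hy : 0 < y) :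
    fermi x - fermi x * (1 - fermi x) * (y - x) ≤ fermi y := by
  have hd : deriv fermi = fun x => -(fermi x * (1 - fermi x)) :=
    funext fun x => (hasDerivAt_fermi x).deriv
  have hanti : ∀ a b : ℝ, a ≤ b → fermi b ≤ fermi a := by
    intro a b hab
    rw [fermi, fermi]
    gcongr
  have hhalf : ∀ a : ℝ, 0 < a → fermi a ≤ 1 / 2 := by
    intro a ha
    have := hanti 0 a ha.le
    simp only [fermi, exp_zero] at this ⊢
    linarith
  have hc : ConvexOn ℝ (Set.Ioi 0) fermi := by
    refine MonotoneOn.convexOn_of_deriv (convex_Ioi 0)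
      (fun x _ => (hasDerivAt_fermi x).continuousAt.continuousWithinAt)
      (fun x _ => (hasDerivAt_fermi x).differentiableAt.differentiableWithinAt) ?_
    rw [interior_Ioi, hd]
    intro a ha b hb hab
    have h1 := hanti a b hab
    have h2 := hhalf a ha
    have h3 := hhalf b hb
    simp only
    nlinarith
  rcases lt_trichotomy x y with h | rfl | h
  · have := hc.le_slope_of_hasDerivAt (Set.mem_Ioi.2 hx) (Set.mem_Ioi.2 hy) h (hasDerivAt_fermi x)
    rw [slope_def_field, le_div_iff₀ (by linarith)] at this
    linarith
  · simp
  · have := hc.slope_le_of_hasDerivAt (Set.mem_Ioi.2 hy) (Set.mem_Ioi.2 hx) h (hasDerivAt_fermi x)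
    rw [slope_def_field, div_le_iff₀ (by linarith)] at this
    linarith

theorem mult_le (j : ℕ) : (mult j : ℝ) ≤ 7 * ((j : ℝ) + 1) ^ 2 := by
  rw [mult]
  push_cast
  have : (0 : ℝ) ≤ j := by positivity
  nlinarith

theorem summable_mult_mul_pow_mul_exp (r : ℕ) {t : ℝ} (ht : 0 < t) :
    Summable fun j : ℕ => (mult j : ℝ) * (((j : ℝ) + 1) ^ r * exp (-((j + 1) * t))) := by
  have h := ((summable_nat_add_iff 1).2 (summable_pow_mul_exp_neg_nat_mul (r + 2) ht)).mul_left 7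
  refine h.of_nonneg_of_le (fun j => by positivity) fun j => ?_
  have h1 := mult_le j
  calc (mult j : ℝ) * (((j : ℝ) + 1) ^ r * exp (-((j + 1) * t)))
      ≤ 7 * ((j : ℝ) + 1) ^ 2 * (((j : ℝ) + 1) ^ r * exp (-((j + 1) * t))) := by gcongr
    _ = _ := by
      push_cast
      rw [pow_add, neg_mul, mul_comm t]
      ring

theorem sum_mult_mul_pow_mul_exp_le (r : ℕ) :
    ∃ K, ∀ t > 0, ∀ N : ℕ,
      ∑ j ∈ Finset.range N, (mult j : ℝ) * (((j : ℝ) + 1) ^ r * exp (-((j + 1) * t))) ≤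
        K / t ^ (r + 4) := by
  have hs : Summable fun j : ℕ => 1 / ((j : ℝ) + 1) ^ 2 := by
    have := (summable_nat_add_iff 1).2 (Real.summable_one_div_nat_pow.2 one_lt_two)
    simpa using this
  refine ⟨7 * (r + 4).factorial * ∑' j : ℕ, 1 / ((j : ℝ) + 1) ^ 2, fun t ht N => ?_⟩
  have h1 : ∀ j : ℕ, (mult j : ℝ) * (((j : ℝ) + 1) ^ r * exp (-((j + 1) * t))) ≤
      7 * (r + 4).factorial / t ^ (r + 4) * (1 / ((j : ℝ) + 1) ^ 2) := by
    intro j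
    have h2 := mult_le j
    have h3 : exp (-((j + 1) * t)) ≤ (r + 4).factorial / ((j + 1) * t) ^ (r + 4) := by
      have := Real.pow_div_factorial_le_exp ((j + 1) * t) (by positivity) (r + 4)
      rw [exp_neg, inv_le_comm₀ (by positivity) (by positivity), inv_div]
      exact this
    calc _ ≤ 7 * ((j : ℝ) + 1) ^ 2 * (((j : ℝ) + 1) ^ r *
          ((r + 4).factorial / ((j + 1) * t) ^ (r + 4))) := by gcongr
      _ = _ := by
        rw [mul_pow, pow_add _ r 4]
        field_simp
  calc _ ≤ ∑ j ∈ Finset.range N, 7 * (r + 4).factorial / t ^ (r + 4) * (1 / ((j : ℝ) + 1) ^ 2) :=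
        Finset.sum_le_sum fun j _ => h1 j
    _ = 7 * (r + 4).factorial / t ^ (r + 4) * ∑ j ∈ Finset.range N, 1 / ((j : ℝ) + 1) ^ 2 := by
        rw [Finset.mul_sum]
    _ ≤ 7 * (r + 4).factorial / t ^ (r + 4) * ∑' j : ℕ, 1 / ((j : ℝ) + 1) ^ 2 := by
        gcongr
        exact hs.sum_le_tsum _ fun j _ => by positivity
    _ = _ := by ring

theorem log_one_add_exp_neg_nonneg (x : ℝ) : 0 ≤ log (1 + exp (-x)) :=
  log_nonneg (by linarith [exp_pos (-x)])

theorem log_one_add_exp_neg_le (x : ℝ) : log (1 + exp (-x)) ≤ exp (-x) := by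
  have := log_le_sub_one_of_pos (show 0 < 1 + exp (-x) by positivity)
  linarith

theorem summable_logSum {t : ℝ} (ht : 0 < t) :
    Summable fun j : ℕ => (mult j : ℝ) * log (1 + exp (-((j + 1) * t))) := by
  refine (summable_mult_mul_pow_mul_exp 0 ht).of_nonneg_of_le
    (fun j => mul_nonneg (by positivity) (log_one_add_exp_neg_nonneg _)) fun j => ?_
  rw [pow_zero, one_mul]
  gcongr
  exact log_one_add_exp_neg_le _

theorem summable_meanSum {t : ℝ} (ht : 0 < t) :
    Summable fun j : ℕ => (mult j : ℝ) * ((j + 1) * fermi ((j + 1) * t)) := by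
  refine (summable_mult_mul_pow_mul_exp 1 ht).of_nonneg_of_le
    (fun j => by have := fermi_pos ((j + 1) * t); positivity) fun j => ?_
  rw [pow_one]
  gcongr
  exact fermi_le_exp_neg _

theorem summable_varSum {t : ℝ} (ht : 0 < t) :
    Summable fun j : ℕ =>
      (mult j : ℝ) * ((j + 1) ^ 2 * (fermi ((j + 1) * t) * (1 - fermi ((j + 1) * t)))) := by
  have h1 : ∀ j : ℕ, 0 ≤ 1 - fermi ((j + 1) * t) := fun j => sub_nonneg.2 (fermi_lt_one _).le
  refine (summable_mult_mul_pow_mul_exp 2 ht).of_nonneg_of_le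
    (fun j => by have := fermi_pos ((j + 1) * t); have := h1 j; positivity) fun j => ?_
  gcongr
  have := fermi_le_exp_neg ((j + 1) * t)
  have := fermi_pos ((j + 1) * t)
  nlinarith [h1 j]

theorem logSum_sub_le {t u : ℝ} (ht : 0 < t) (hu : 0 < u) :
    logSum t - meanSum t * (u - t) ≤ logSum u := by
  rw [logSum, meanSum, logSum, ← tsum_mul_right,
    ← (summable_logSum ht).tsum_sub ((summable_meanSum ht).mul_right _)]
  refine ((summable_logSum ht).sub ((summable_meanSum ht).mul_right _)).tsum_le_tsum ?_
    (summable_logSum hu)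
  intro j
  have := mul_le_mul_of_nonneg_left (log_one_add_exp_neg_sub_le ((j + 1) * t) ((j + 1) * u))
    (Nat.cast_nonneg (α := ℝ) (mult j))
  linarith

theorem meanSum_sub_le {t u : ℝ} (ht : 0 < t) (hu : 0 < u) :
    meanSum t - varSum t * (u - t) ≤ meanSum u := by
  rw [meanSum, varSum, meanSum, ← tsum_mul_right,
    ← (summable_meanSum ht).tsum_sub ((summable_varSum ht).mul_right _)]
  refine ((summable_meanSum ht).sub ((summable_varSum ht).mul_right _)).tsum_le_tsum ?_
    (summable_meanSum hu)
  intro j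
  have := mul_le_mul_of_nonneg_left
    (fermi_sub_le (x := (j + 1) * t) (y := (j + 1) * u) (by positivity) (by positivity))
    (by positivity : (0 : ℝ) ≤ mult j * (j + 1))
  linarith

/-- Asymptotics of a convex function pass to its subgradient. -/
theorem tendsto_subgradient {g m g₀ m₀ s e : ℝ → ℝ} {K : ℝ} (hK : 0 ≤ K)
    (hsub : ∀ t > 0, ∀ u > 0, g t - m t * (u - t) ≤ g u)
    (hs : ∀ᶠ t in 𝓝[>] 0, 0 < s t ∧ s t ≤ t / 2)
    (he : ∀ᶠ t in 𝓝[>] 0, 0 < e t)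
    (hg : ∀ ε > 0, ∀ᶠ t in 𝓝[>] 0, ∀ u, |u - t| ≤ s t → |g u - g₀ u| ≤ ε * e t)
    (hm : ∀ᶠ t in 𝓝[>] 0, ∀ u, |u - t| ≤ s t →
      |g₀ u - g₀ t + m₀ t * (u - t)| ≤ K * e t * ((u - t) / s t) ^ 2) :
    Tendsto (fun t => s t / e t * (m t - m₀ t)) (𝓝[>] 0) (𝓝 0) := by
  rw [Metric.tendsto_nhds]
  intro ε' hε'
  obtain ⟨ε, hε, hε1, hε2⟩ : ∃ ε > 0, ε ≤ 1 ∧ (K + 2) * ε < ε' := by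
    refine ⟨min 1 (ε' / (2 * (K + 2))), by positivity, min_le_left _ _, ?_⟩
    calc (K + 2) * min 1 (ε' / (2 * (K + 2))) ≤ (K + 2) * (ε' / (2 * (K + 2))) := by
          gcongr
          exact min_le_right _ _
      _ = ε' / 2 := by field_simp
      _ < ε' := by linarith
  filter_upwards [self_mem_nhdsWithin, hs, he, hg (ε ^ 2) (by positivity), hm]
    with t ht hst het hgt hmt
  have ht : 0 < t := ht
  obtain ⟨hs0, hs1⟩ := hst
  have hδ : 0 < ε * s t := by positivity
  have hδs : ε * s t ≤ s t := by nlinarith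
  have key : ∀ σ : ℝ, |σ| = 1 → -(m t - m₀ t) * σ * (ε * s t) ≤ (K + 2) * ε ^ 2 * e t := by
    intro σ hσ
    have habs : |t + σ * (ε * s t) - t| = ε * s t := by
      rw [add_sub_cancel_left, abs_mul, hσ, one_mul, abs_of_pos hδ]
    have hu : 0 < t + σ * (ε * s t) := by
      have := abs_le.1 habs.le
      linarith [this.1]
    have h1 := hsub t ht _ hu
    have h2 := (abs_le.1 (hgt _ (habs.le.trans hδs))).2
    have h3 := (abs_le.1 (hgt t (by simpa using hs0.le))).1
    have h4 := (abs_le.1 (hmt _ (habs.le.trans hδs))).2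
    have h5 : ((t + σ * (ε * s t) - t) / s t) ^ 2 = ε ^ 2 := by
      rw [← sq_abs, abs_div, habs, abs_of_pos hs0]
      field_simp
    rw [h5] at h4
    rw [add_sub_cancel_left] at h1 h4
    linarith
  have k1 := key 1 (by simp)
  have k2 := key (-1) (by simp)
  rw [Real.dist_eq, sub_zero, abs_mul, abs_of_pos (by positivity : 0 < s t / e t)]
  refine lt_of_le_of_lt ?_ hε2
  have h6 : |m t - m₀ t| * (ε * s t) ≤ (K + 2) * ε ^ 2 * e t := by
    rcases abs_cases (m t - m₀ t) with h | h <;> rw [h.1] <;> linarith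
  rw [div_mul_eq_mul_div, div_le_iff₀ het]
  have : ε * (s t * |m t - m₀ t|) ≤ ε * ((K + 2) * ε * e t) := by linarith
  exact le_of_mul_le_mul_left this hε

theorem abs_inv_sub_inv_add_le {t u : ℝ} (ht : 0 < t) (hu : t / 2 ≤ u) :
    |1 / u - 1 / t + 1 / t ^ 2 * (u - t)| ≤ 2 * (u - t) ^ 2 / t ^ 3 ∧
    |1 / u ^ 2 - 1 / t ^ 2 + 2 / t ^ 3 * (u - t)| ≤ 8 * (u - t) ^ 2 / t ^ 4 ∧
    |1 / u ^ 3 - 1 / t ^ 3 + 3 / t ^ 4 * (u - t)| ≤ 22 * (u - t) ^ 2 / t ^ 5 ∧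
    |1 / u ^ 4 - 1 / t ^ 4 + 4 / t ^ 5 * (u - t)| ≤ 52 * (u - t) ^ 2 / t ^ 6 := by
  have hu0 : 0 < u := by linarith
  have h1 : 1 / u ≤ 2 / t := by
    rw [div_le_div_iff₀ hu0 ht]
    linarith
  obtain ⟨v, rfl⟩ : ∃ v, u = 1 / v := ⟨1 / u, by simp⟩
  obtain ⟨w, rfl⟩ : ∃ w, t = 1 / w := ⟨1 / t, by simp⟩
  have hv : 0 < v := by simpa using hu0
  have hw : 0 < w := by simpa using ht
  have hvw : v ≤ 2 * w := by simpa using h1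
  have hsq : 0 ≤ (1 / v - 1 / w) ^ 2 := sq_nonneg _
  have h2 : v ^ 2 ≤ (2 * w) ^ 2 := by gcongr
  have h3 : v ^ 3 ≤ (2 * w) ^ 3 := by gcongr
  have h4 : v ^ 4 ≤ (2 * w) ^ 4 := by gcongr
  refine ⟨?_, ?_, ?_, ?_⟩
  · have : 1 / (1 / v) - 1 / (1 / w) + 1 / (1 / w) ^ 2 * (1 / v - 1 / w) =
      (1 / v - 1 / w) ^ 2 * (v * w ^ 2) := by field_simp; ring
    rw [this, abs_of_nonneg (by positivity)]
    calc _ ≤ (1 / v - 1 / w) ^ 2 * (2 * w * w ^ 2) := by gcongr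
      _ = _ := by field_simp
  · have : 1 / (1 / v) ^ 2 - 1 / (1 / w) ^ 2 + 2 / (1 / w) ^ 3 * (1 / v - 1 / w) =
      (1 / v - 1 / w) ^ 2 * (2 * v * w ^ 3 + v ^ 2 * w ^ 2) := by field_simp; ring
    rw [this, abs_of_nonneg (by positivity)]
    calc _ ≤ (1 / v - 1 / w) ^ 2 * (2 * (2 * w) * w ^ 3 + (2 * w) ^ 2 * w ^ 2) := by gcongr
      _ = _ := by field_simp; ring
  · have : 1 / (1 / v) ^ 3 - 1 / (1 / w) ^ 3 + 3 / (1 / w) ^ 4 * (1 / v - 1 / w) =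
      (1 / v - 1 / w) ^ 2 * (3 * v * w ^ 4 + 2 * v ^ 2 * w ^ 3 + v ^ 3 * w ^ 2) := by
        field_simp; ring
    rw [this, abs_of_nonneg (by positivity)]
    calc _ ≤ (1 / v - 1 / w) ^ 2 *
          (3 * (2 * w) * w ^ 4 + 2 * (2 * w) ^ 2 * w ^ 3 + (2 * w) ^ 3 * w ^ 2) := by gcongr
      _ = _ := by field_simp; ring
  · have : 1 / (1 / v) ^ 4 - 1 / (1 / w) ^ 4 + 4 / (1 / w) ^ 5 * (1 / v - 1 / w) =
      (1 / v - 1 / w) ^ 2 * (4 * v * w ^ 5 + 3 * v ^ 2 * w ^ 4 + 2 * v ^ 3 * w ^ 3 +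
        v ^ 4 * w ^ 2) := by
        field_simp; ring
    rw [this, abs_of_nonneg (by positivity)]
    calc _ ≤ (1 / v - 1 / w) ^ 2 * (4 * (2 * w) * w ^ 5 + 3 * (2 * w) ^ 2 * w ^ 4 +
          2 * (2 * w) ^ 3 * w ^ 3 + (2 * w) ^ 4 * w ^ 2) := by gcongr
      _ = _ := by field_simp; ring

/-! ### The Bose kernel near zero -/

theorem analyticOnNhd_dslope {f : ℝ → ℝ} (hf : AnalyticOnNhd ℝ f Set.univ) :
    AnalyticOnNhd ℝ (dslope f 0) Set.univ := by
  intro b _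
  by_cases hb : b = 0
  · subst hb
    obtain ⟨p, hp⟩ := hf 0 (Set.mem_univ _)
    exact ⟨_, hp.has_fpower_series_dslope_fslope⟩
  · have h1 : AnalyticAt ℝ (fun y => (y - 0)⁻¹ * (f y - f 0)) b :=
      ((analyticAt_id.sub analyticAt_const).inv (by simpa using hb)).mul
        ((hf b (Set.mem_univ _)).sub analyticAt_const)
    refine h1.congr ?_
    filter_upwards [dslope_eventuallyEq_slope_of_ne f hb] with y hy
    rw [hy, slope_def_field, sub_zero, div_eq_inv_mul]

theorem eq_of_continuous_of_abs_sub_le {F : ℝ → ℝ} {c K : ℝ} (hF : Continuous F)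
    (h : ∀ y, y ≠ 0 → |y| ≤ 1 → |F y - c| ≤ K * |y|) : F 0 = c := by
  have h1 : Tendsto F (𝓝[≠] 0) (𝓝 (F 0)) := hF.continuousAt.tendsto.mono_left nhdsWithin_le_nhds
  have h2 : Tendsto F (𝓝[≠] 0) (𝓝 c) := by
    rw [tendsto_iff_norm_sub_tendsto_zero]
    have h3 : Tendsto (fun y : ℝ => K * |y|) (𝓝[≠] 0) (𝓝 0) := by
      have : Continuous fun y : ℝ => K * |y| := by fun_prop
      simpa using this.continuousAt.tendsto.mono_left (nhdsWithin_le_nhds (a := (0 : ℝ)))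
    refine squeeze_zero' (Eventually.of_forall fun _ => norm_nonneg _) ?_ h3
    filter_upwards [self_mem_nhdsWithin, nhdsWithin_le_nhds (Metric.closedBall_mem_nhds 0 one_pos)]
      with y hy hy1
    exact h y hy (by simpa using hy1)
  exact tendsto_nhds_unique h1 h2

theorem eq_add_mul_dslope (f : ℝ → ℝ) (y : ℝ) : f y = f 0 + y * dslope f 0 y := by
  have := sub_smul_dslope f 0 y
  simp only [sub_zero, smul_eq_mul] at this
  linarith

theorem exists_exp_eq_cubic :
    ∃ E : ℝ → ℝ, AnalyticOnNhd ℝ E Set.univ ∧ E 0 = 1 / 6 ∧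
      ∀ y, exp y = 1 + y + y ^ 2 / 2 + y ^ 3 * E y := by
  have a0 : AnalyticOnNhd ℝ rexp Set.univ := fun y _ => analyticAt_rexp
  have a1 := analyticOnNhd_dslope a0
  have a2 := analyticOnNhd_dslope a1
  have a3 := analyticOnNhd_dslope a2
  have c2 : Continuous _ := continuousOn_univ.1 a2.continuousOn
  have c3 : Continuous _ := continuousOn_univ.1 a3.continuousOn
  have e1 : dslope rexp 0 0 = 1 := by simp [dslope_same]
  have e2 : dslope (dslope rexp 0) 0 0 = 1 / 2 := by
    refine eq_of_continuous_of_abs_sub_le (K := 1) c2 fun y hy hy1 => ?_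
    have h1 := eq_add_mul_dslope rexp y
    have h2 := eq_add_mul_dslope (dslope rexp 0) y
    rw [e1] at h2
    rw [h2, exp_zero] at h1
    have h3 := Real.exp_bound hy1 (n := 3) (by norm_num)
    simp only [Finset.sum_range_succ, Finset.sum_range_zero] at h3
    norm_num [Nat.factorial] at h3
    rw [h1] at h3
    have h4 : 1 + y * (1 + y * dslope (dslope rexp 0) 0 y) - (1 + y + y ^ 2 / 2) =
      y ^ 2 * (dslope (dslope rexp 0) 0 y - 1 / 2) := by ring
    rw [h4, abs_mul, abs_of_pos (by positivity : 0 < y ^ 2)] at h3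
    have h5 : |y| ^ 3 = y ^ 2 * |y| := by rw [← sq_abs]; ring
    rw [h5] at h3
    have h6 : y ^ 2 * |dslope (dslope rexp 0) 0 y - 1 / 2| ≤ y ^ 2 * (1 * |y|) := by
      have : 0 ≤ y ^ 2 * |y| := by positivity
      linarith
    exact le_of_mul_le_mul_left h6 (by positivity)
  have key : ∀ y, exp y =
      1 + y + y ^ 2 / 2 + y ^ 3 * dslope (dslope (dslope rexp 0) 0) 0 y := by
    intro y
    have h1 := eq_add_mul_dslope rexp y
    have h2 := eq_add_mul_dslope (dslope rexp 0) y
    have h3 := eq_add_mul_dslope (dslope (dslope rexp 0) 0) y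
    rw [e1] at h2
    rw [e2] at h3
    rw [h2, h3, exp_zero] at h1
    rw [h1]
    ring
  refine ⟨_, a3, ?_, key⟩
  refine eq_of_continuous_of_abs_sub_le (K := 1) c3 fun y hy hy1 => ?_
  have h3 := Real.exp_bound hy1 (n := 4) (by norm_num)
  simp only [Finset.sum_range_succ, Finset.sum_range_zero] at h3
  norm_num [Nat.factorial] at h3
  rw [key y] at h3
  have h4 : 1 + y + y ^ 2 / 2 + y ^ 3 * dslope (dslope (dslope rexp 0) 0) 0 y -
      (1 + y + y ^ 2 / 2 + y ^ 3 / 6) =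
      y ^ 3 * (dslope (dslope (dslope rexp 0) 0) 0 y - 1 / 6) := by ring
  rw [h4, abs_mul, abs_pow] at h3
  have h6 : |y| ^ 3 * |dslope (dslope (dslope rexp 0) 0) 0 y - 1 / 6| ≤ |y| ^ 3 * (1 * |y|) := by
    have : 0 ≤ |y| ^ 3 * |y| := by positivity
    rw [pow_succ |y| 3] at h3
    linarith
  exact le_of_mul_le_mul_left h6 (by positivity)

theorem exists_bose_expansion :
    ∃ η : ℝ → ℝ, AnalyticOnNhd ℝ η Set.univ ∧ η 0 = 0 ∧
      ∀ y, y ≠ 0 → 1 / (exp y - 1) = 1 / y - 1 / 2 + y * (1 / 12 + y * η y) := by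
  obtain ⟨E, hE, hE0, hexp⟩ := exists_exp_eq_cubic
  have hD : ∀ y : ℝ, 1 + y / 2 + y ^ 2 * E y ≠ 0 := by
    intro y h
    by_cases hy : y = 0
    · subst hy
      norm_num at h
    · have h1 := hexp y
      have h2 : exp y = 1 + y * (1 + y / 2 + y ^ 2 * E y) := by rw [h1]; ring
      rw [h, mul_zero, add_zero, exp_eq_one_iff] at h2
      exact hy h2
  set γ : ℝ → ℝ := fun y => (1 / 4 - E y + y * E y / 2) / (1 + y / 2 + y ^ 2 * E y) with hγ
  have hγa : AnalyticOnNhd ℝ γ Set.univ := by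
    intro y _
    have := hE y (Set.mem_univ y)
    exact AnalyticAt.div (by fun_prop) (by fun_prop) (hD y)
  have hγ0 : γ 0 = 1 / 12 := by
    simp only [hγ, hE0]
    norm_num
  have hw : ∀ y, y ≠ 0 → 1 / (exp y - 1) = 1 / y - 1 / 2 + y * γ y := by
    intro y hy
    have h1 : exp y - 1 = y * (1 + y / 2 + y ^ 2 * E y) := by rw [hexp]; ring
    have h2 := hD y
    simp only [h1, hγ]
    generalize h3 : 1 + y / 2 + y ^ 2 * E y = D at h2
    field_simp
    rw [← h3]
    ring
  have heven : ∀ y, γ (-y) = γ y := by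
    intro y
    by_cases hy : y = 0
    · simp [hy]
    · have h1 := hw y hy
      have h2 := hw (-y) (neg_ne_zero.2 hy)
      have h3 : exp y - 1 ≠ 0 := sub_ne_zero.2 fun h => hy (exp_eq_one_iff y |>.1 h)
      have h4 : exp (-y) - 1 ≠ 0 := sub_ne_zero.2 fun h => hy (by simpa using h)
      have h5 : 1 / (exp (-y) - 1) = -1 - 1 / (exp y - 1) := by
        have h6 : exp (-y) = 1 / exp y := by rw [exp_neg, one_div]
        have := exp_pos y
        rw [h6, div_eq_iff (by rwa [← h6])]
        field_simp
        ring
      rw [h5, h1, one_div_neg_eq_neg_one_div] at h2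
      have h7 : y * γ (-y) = y * γ y := by linarith
      exact mul_left_cancel₀ hy h7
  refine ⟨dslope γ 0, analyticOnNhd_dslope hγa, ?_, ?_⟩
  · rw [dslope_same]
    have h1 := deriv_comp_neg γ 0
    simp only [heven, neg_zero] at h1
    change deriv γ 0 = -deriv γ 0 at h1
    linarith
  · intro y hy
    rw [hw y hy, ← hγ0, ← eq_add_mul_dslope]

/-- The generating function `∑ mult j * e ^ (-(j + 1) y)` of the multiplicities with its polar part
at `0` removed. -/
noncomputable def reg (y : ℝ) : ℝ :=
  6 * (1 / (exp y - 1)) * (1 / (exp y - 1) + 1) ^ 2 + 1 / (exp y - 1)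
    - 6 / y ^ 3 - 3 / y ^ 2 - 1 / y

theorem exists_reg_extension :
    ∃ F : ℝ → ℝ, AnalyticOnNhd ℝ F Set.univ ∧ F 0 = -3 / 4 ∧ ∀ y > 0, reg y = F y := by
  obtain ⟨η, hη, hη0, hw⟩ := exists_bose_expansion
  refine ⟨fun y => 18 * η y + 18 * y * (1 / 12 + y * η y) ^ 2 + 6 * y ^ 3 * (1 / 12 + y * η y) ^ 3
    + 6 * (1 / 12 + y * η y) + 3 * y ^ 2 * (1 / 12 + y * η y) ^ 2 - y * (1 / 12 + y * η y) / 2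
    - 5 / 4, ?_, ?_, ?_⟩
  · intro y _
    have := hη y (Set.mem_univ y)
    fun_prop
  · simp only [hη0]
    norm_num
  · intro y hy
    rw [reg, hw y hy.ne']
    field_simp
    ring

theorem one_div_exp_sub_one_le {y : ℝ} (hy : 0 < y) : 1 / (exp y - 1) ≤ 1 / y := by
  have := add_one_le_exp y
  exact one_div_le_one_div_of_le hy (by linarith)

theorem hasDerivAt_reg {y : ℝ} (hy : 0 < y) :
    HasDerivAt reg (-(1 / (exp y - 1)) * (1 / (exp y - 1) + 1) *
      (18 * (1 / (exp y - 1)) ^ 2 + 24 * (1 / (exp y - 1)) + 7)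
      + 18 / y ^ 4 + 6 / y ^ 3 + 1 / y ^ 2) y := by
  have h1 : exp y - 1 ≠ 0 := by
    have := add_one_le_exp y
    linarith
  have hw : HasDerivAt (fun y => 1 / (exp y - 1)) (-(1 / (exp y - 1)) * (1 / (exp y - 1) + 1)) y := by
    have := ((hasDerivAt_exp y).sub_const 1).inv h1
    simp only [one_div]
    refine this.congr_deriv ?_
    field_simp
    ring
  have hp : ∀ k : ℕ, HasDerivAt (fun y : ℝ => y ^ k) (k * y ^ (k - 1)) y := fun k => hasDerivAt_pow k y
  have h3 := (hasDerivAt_const y (6 : ℝ)).div (hp 3) (by positivity)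
  have h2 := (hasDerivAt_const y (3 : ℝ)).div (hp 2) (by positivity)
  have hi := (hasDerivAt_const y (1 : ℝ)).div (hasDerivAt_id y) hy.ne'
  have := ((((hw.const_mul 6).mul ((hw.add_const 1).pow 2)).add hw).sub h3).sub h2 |>.sub hi
  refine this.congr_deriv ?_
  norm_num
  field_simp
  ring

theorem exists_reg_bounds :
    ∃ K > 0, (∀ y > 0, |reg y| ≤ K / y) ∧ ∀ y > 0, ∀ z > 0, |reg y - reg z| ≤ K * |y - z| := by
  obtain ⟨F, hF, -, hreg⟩ := exists_reg_extension
  have hFc : Continuous F := continuousOn_univ.1 hF.continuousOn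
  have hFd : Continuous (deriv F) := continuousOn_univ.1 hF.deriv.continuousOn
  obtain ⟨K₁, h₁⟩ := (isCompact_Icc (a := (0 : ℝ)) (b := 1)).exists_bound_of_continuousOn
    hFc.continuousOn
  obtain ⟨K₂, h₂⟩ := (isCompact_Icc (a := (0 : ℝ)) (b := 1)).exists_bound_of_continuousOn
    hFd.continuousOn
  have hK₁ : 0 ≤ K₁ := (norm_nonneg _).trans (h₁ 0 (by simp))
  have hK₂ : 0 ≤ K₂ := (norm_nonneg _).trans (h₂ 0 (by simp))
  have hbig : ∀ y : ℝ, 1 ≤ y → 0 < 1 / (exp y - 1) ∧ 1 / (exp y - 1) ≤ 1 ∧ 1 / y ≤ 1 := by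
    intro y hy
    have h := add_one_le_exp y
    refine ⟨by apply one_div_pos.2; linarith, ?_, ?_⟩
    · refine (one_div_exp_sub_one_le (by linarith)).trans ?_
      rw [div_le_one (by linarith)]
      exact hy
    · rw [div_le_one (by linarith)]
      exact hy
  refine ⟨K₁ + K₂ + 200, by positivity, fun y hy => ?_, fun y hy z hz => ?_⟩
  · rcases le_total y 1 with h | h
    · rw [hreg y hy, le_div_iff₀ hy]
      have := h₁ y ⟨hy.le, h⟩
      rw [Real.norm_eq_abs] at this
      nlinarith [abs_nonneg (F y)]
    · obtain ⟨b1, b2, b3⟩ := hbig y h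
      have b4 := one_div_exp_sub_one_le hy
      have b5 : 0 < 1 / y := by positivity
      rw [reg]
      have e3 : 6 / y ^ 3 = 6 * (1 / y) ^ 3 := by field_simp
      have e2 : 3 / y ^ 2 = 3 * (1 / y) ^ 2 := by field_simp
      have e1 : (K₁ + K₂ + 200) / y = (K₁ + K₂ + 200) * (1 / y) := by field_simp
      rw [e3, e2, e1]
      generalize 1 / (exp y - 1) = w at *
      generalize 1 / y = v at *
      have c1 : (w + 1) ^ 2 ≤ 4 := by nlinarith
      have c2 : w * (w + 1) ^ 2 ≤ v * 4 := by gcongr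
      have c3 : v ^ 2 ≤ v := by nlinarith
      have c4 : v ^ 3 ≤ v := by nlinarith
      have c5 : 0 ≤ w * (w + 1) ^ 2 := by positivity
      have c6 : 0 ≤ v ^ 2 := by positivity
      have c7 : 0 ≤ v ^ 3 := by positivity
      rw [abs_le]
      constructor <;> nlinarith
  · have hd : ∀ x ∈ Set.Ioi (0 : ℝ), DifferentiableAt ℝ reg x :=
      fun x hx => (hasDerivAt_reg hx).differentiableAt
    refine Convex.norm_image_sub_le_of_norm_deriv_le hd (fun x hx => ?_) (convex_Ioi 0) hz hy
    have hx : 0 < x := hx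
    rcases le_total x 1 with h | h
    · have h3 : deriv reg x = deriv F x := by
        refine Filter.EventuallyEq.deriv_eq ?_
        filter_upwards [lt_mem_nhds hx] with y hy using hreg y hy
      rw [h3]
      have := h₂ x ⟨hx.le, h⟩
      linarith
    · obtain ⟨b1, b2, b3⟩ := hbig x h
      have b5 : 0 < 1 / x := by positivity
      rw [(hasDerivAt_reg hx).deriv]
      have e4 : 18 / x ^ 4 = 18 * (1 / x) ^ 4 := by field_simp
      have e3 : 6 / x ^ 3 = 6 * (1 / x) ^ 3 := by field_simp
      have e2 : 1 / x ^ 2 = (1 / x) ^ 2 := by field_simp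
      rw [e4, e3, e2]
      generalize 1 / (exp x - 1) = w at *
      generalize 1 / x = v at *
      have d2 : v ^ 2 ≤ 1 := pow_le_one₀ b5.le b3
      have d3 : v ^ 3 ≤ 1 := pow_le_one₀ b5.le b3
      have d4 : v ^ 4 ≤ 1 := pow_le_one₀ b5.le b3
      have d5 : w * (w + 1) * (18 * w ^ 2 + 24 * w + 7) ≤ 1 * (1 + 1) * (18 * 1 ^ 2 + 24 * 1 + 7) := by
        gcongr
      have d6 : 0 ≤ w * (w + 1) * (18 * w ^ 2 + 24 * w + 7) := by positivity
      have d7 : 0 ≤ v ^ 2 := by positivity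
      have d8 : 0 ≤ v ^ 3 := by positivity
      have d9 : 0 ≤ v ^ 4 := by positivity
      rw [Real.norm_eq_abs, abs_le]
      constructor <;> linarith

theorem tendsto_reg : Tendsto reg (𝓝[>] 0) (𝓝 (-3 / 4)) := by
  obtain ⟨F, hF, hF0, hreg⟩ := exists_reg_extension
  have hFc : Continuous F := continuousOn_univ.1 hF.continuousOn
  rw [← hF0]
  refine (hFc.continuousAt.tendsto.mono_left nhdsWithin_le_nhds).congr' ?_
  filter_upwards [self_mem_nhdsWithin] with y hy using (hreg y hy).symm

/-! ### The asymptotic expansion of `logSum` -/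

theorem hasSum_alternating {s : ℕ} {Z : ℝ} (h : HasSum (fun n : ℕ => 1 / ((n : ℝ) + 1) ^ s) Z) :
    HasSum (fun n : ℕ => (-1) ^ n / ((n : ℝ) + 1) ^ s) (Z - 2 * (Z / 2 ^ s)) := by
  have hodd : HasSum (fun k : ℕ => 1 / (((2 * k + 1 : ℕ) : ℝ) + 1) ^ s) (Z / 2 ^ s) := by
    refine (h.div_const (2 ^ s)).congr_fun ?_
    intro k
    push_cast
    rw [div_div, ← mul_pow]
    congr 2
    ring
  have hev : Summable (fun k : ℕ => 1 / (((2 * k : ℕ) : ℝ) + 1) ^ s) :=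
    h.summable.comp_injective (i := fun k : ℕ => 2 * k) fun a b hab => by simpa using hab
  obtain ⟨Y, hY⟩ := hev
  have hZ : Y + Z / 2 ^ s = Z :=
    (HasSum.even_add_odd (f := fun n : ℕ => 1 / ((n : ℝ) + 1) ^ s) hY hodd).unique h
  have : Z - 2 * (Z / 2 ^ s) = Y + -(Z / 2 ^ s) := by linarith
  rw [this]
  refine HasSum.even_add_odd ?_ ?_
  · simpa using hY
  · refine hodd.neg.congr_fun fun k => ?_
    rw [pow_succ, pow_mul]
    simp only [even_two, Even.neg_pow, one_pow, one_mul]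
    rw [neg_div]

theorem hasSum_one_div_add_one_pow {s : ℕ} (hs : s ≠ 0) {Z : ℝ}
    (h : HasSum (fun n : ℕ => 1 / (n : ℝ) ^ s) Z) :
    HasSum (fun n : ℕ => 1 / ((n : ℝ) + 1) ^ s) Z := by
  have := (hasSum_nat_add_iff' 1).2 h
  simpa [hs] using this

theorem hasSum_realZeta_three : HasSum (fun n : ℕ => 1 / (n : ℝ) ^ 3) (realZeta 3) := by
  have h1 : realZeta 3 = ∑' n : ℕ, 1 / (n : ℝ) ^ 3 := by
    have := zeta_nat_eq_tsum_of_gt_one (k := 3) (by norm_num)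
    rw [realZeta]
    push_cast at this ⊢
    rw [this]
    have h2 : ∀ n : ℕ, 1 / (n : ℂ) ^ 3 = ((1 / (n : ℝ) ^ 3 : ℝ) : ℂ) := fun n => by push_cast; rfl
    simp_rw [h2]
    rw [← Complex.ofReal_tsum, Complex.ofReal_re]
  rw [h1]
  exact (Real.summable_one_div_nat_pow.2 (by norm_num)).hasSum

theorem hasSum_alternating_harmonic :
    HasSum (fun k : ℕ => 1 / (2 * (k : ℝ) + 1) - 1 / (2 * (k : ℝ) + 2)) (log 2) := by
  rw [hasSum_iff_tendsto_nat_of_nonneg]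
  · have h1 : ∀ N : ℕ, ∑ k ∈ Finset.range N, (1 / (2 * (k : ℝ) + 1) - 1 / (2 * (k : ℝ) + 2)) =
        (harmonic (2 * N) : ℝ) - harmonic N := by
      intro N
      induction N with
      | zero => simp
      | succ N ih =>
        rw [Finset.sum_range_succ, ih, show 2 * (N + 1) = 2 * N + 1 + 1 by ring, harmonic_succ,
          harmonic_succ, harmonic_succ]
        push_cast
        field_simp
        ring
    simp_rw [h1]
    have h2 := Real.tendsto_harmonic_sub_log
    have h3 : Tendsto (fun N : ℕ => 2 * N) atTop atTop :=
      tendsto_id.const_mul_atTop' (by norm_num)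
    have h4 := ((h2.comp h3).sub h2).add_const (log 2)
    rw [sub_self, zero_add] at h4
    refine h4.congr' ?_
    filter_upwards [eventually_gt_atTop 0] with N hN
    have : (0 : ℝ) < N := by exact_mod_cast hN
    simp only [Function.comp]
    push_cast
    rw [log_mul (by norm_num) this.ne']
    ring
  · intro k
    rw [sub_nonneg]
    gcongr
    norm_num

theorem hasSum_mult_mul_exp {y : ℝ} (hy : 0 < y) :
    HasSum (fun j : ℕ => (mult j : ℝ) * exp (-((j + 1) * y)))
      (reg y + 6 / y ^ 3 + 3 / y ^ 2 + 1 / y) := by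
  have hq : ‖exp (-y)‖ < 1 := by
    rw [Real.norm_eq_abs, abs_of_pos (exp_pos _)]
    exact exp_lt_one_iff.2 (by linarith)
  have h1 := (hasSum_choose_mul_geometric_of_norm_lt_one 2 hq).mul_left (6 * exp (-y))
  have h2 := (hasSum_geometric_of_norm_lt_one hq).mul_left (exp (-y))
  have h3 := h1.add h2
  have h4 : reg y + 6 / y ^ 3 + 3 / y ^ 2 + 1 / y =
      6 * exp (-y) * (1 / (1 - exp (-y)) ^ (2 + 1)) + exp (-y) * (1 - exp (-y))⁻¹ := by
    have h5 : exp y - 1 ≠ 0 := by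
      have := add_one_le_exp y
      linarith
    have h6 : exp (-y) = 1 / exp y := by rw [exp_neg, one_div]
    have h7 : 1 - 1 / exp y = (exp y - 1) / exp y := by
      have := exp_pos y
      field_simp
    have h8 := exp_pos y
    rw [reg, h6, h7]
    obtain ⟨z, hz⟩ : ∃ z, z = exp y - 1 := ⟨_, rfl⟩
    have h9 : exp y = z + 1 := by rw [hz]; ring
    rw [← hz] at h5 ⊢
    rw [h9] at h8 ⊢
    have h10 : 6 * (1 / (z + 1)) * (1 / (z / (z + 1)) ^ (2 + 1)) + 1 / (z + 1) * (z / (z + 1))⁻¹ =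
        6 * (z + 1) ^ 2 / z ^ 3 + 1 / z := by
      rw [div_pow, inv_div, one_div_div]
      field_simp
      ring
    rw [h10]
    field_simp
    ring
  rw [h4]
  refine h3.congr_fun fun j => ?_
  have h5 : exp (-((j + 1) * y)) = exp (-y) * exp (-y) ^ j := by
    rw [← Real.exp_nat_mul, ← exp_add]
    congr 1
    ring
  have h6 : ((j + 2).choose 2 : ℝ) = (j + 2) * (j + 1) / 2 := by
    rw [Nat.cast_choose_two]
    push_cast
    ring
  rw [h5, h6, mult]
  push_cast
  ring

theorem summable_mult_mul_exp_prod {t : ℝ} (ht : 0 < t) :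
    Summable fun p : ℕ × ℕ =>
      (mult p.1 : ℝ) * ((-1) ^ p.2 * exp (-((p.1 + 1) * ((p.2 + 1) * t))) / (p.2 + 1)) := by
  have h1 := summable_mult_mul_pow_mul_exp 0 (half_pos ht)
  have h2 : Summable fun i : ℕ => exp (-((i + 1) * (t / 2))) := by
    have := (summable_nat_add_iff 1).2 (summable_pow_mul_exp_neg_nat_mul 0 (half_pos ht))
    refine this.congr fun i => ?_
    push_cast
    rw [pow_zero, one_mul]
    congr 1
    ring
  refine .of_norm_bounded (h1.mul_of_nonneg h2 (fun j => by positivity) fun i => by positivity) ?_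
  rintro ⟨j, i⟩
  simp only [norm_mul, norm_div, norm_pow, norm_neg, norm_one, one_pow, one_mul, pow_zero]
  rw [Real.norm_of_nonneg (by positivity), Real.norm_of_nonneg (by positivity),
    Real.norm_of_nonneg (by positivity), mul_assoc, ← exp_add]
  have h3 : exp (-(((j : ℝ) + 1) * ((i + 1) * t))) ≤
      exp (-((j + 1) * (t / 2)) + -((i + 1) * (t / 2))) := by
    rw [exp_le_exp]
    have : (0 : ℝ) ≤ j * i * t + (j + i) * t / 2 := by positivity
    nlinarith
  gcongr
  refine (div_le_self (by positivity) (by linarith [(Nat.cast_nonneg i : (0 : ℝ) ≤ i)])).trans h3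

theorem logSum_eq_tsum {t : ℝ} (ht : 0 < t) :
    logSum t = ∑' i : ℕ, (-1) ^ i / ((i : ℝ) + 1) * (reg ((i + 1) * t) + 6 / ((i + 1) * t) ^ 3 +
      3 / ((i + 1) * t) ^ 2 + 1 / ((i + 1) * t)) := by
  have h1 : ∀ j : ℕ, (mult j : ℝ) * log (1 + exp (-((j + 1) * t))) =
      ∑' i : ℕ, (mult j : ℝ) * ((-1) ^ i * exp (-((j + 1) * ((i + 1) * t))) / (i + 1)) := by
    intro j
    rw [tsum_mul_left]
    congr 1
    have hq : |-exp (-((j + 1) * t))| < 1 := by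
      rw [abs_neg, abs_of_pos (exp_pos _), exp_lt_one_iff]
      have : 0 < ((j : ℝ) + 1) * t := by positivity
      linarith
    have h2 := (Real.hasSum_pow_div_log_of_abs_lt_one hq).neg.tsum_eq
    rw [neg_neg, sub_neg_eq_add] at h2
    rw [← h2]
    refine tsum_congr fun i => ?_
    have h3 : exp (-((j + 1) * ((i + 1) * t))) = exp (-((j + 1) * t)) ^ (i + 1) := by
      rw [← Real.exp_nat_mul]
      congr 1
      push_cast
      ring
    rw [h3, neg_pow, pow_succ (-1 : ℝ) i]
    ring
  have hswap := Summable.tsum_comm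
    (f := fun j i : ℕ => (mult j : ℝ) * ((-1) ^ i * exp (-((j + 1) * ((i + 1) * t))) / (i + 1)))
    (summable_mult_mul_exp_prod ht)
  rw [logSum, tsum_congr h1, ← hswap]
  refine tsum_congr fun i => ?_
  rw [← (hasSum_mult_mul_exp (y := (i + 1) * t) (by positivity)).tsum_eq, ← tsum_mul_left]
  refine tsum_congr fun j => ?_
  ring

theorem summable_alternating_reg {t : ℝ} (ht : 0 < t) :
    Summable fun i : ℕ => (-1) ^ i / ((i : ℝ) + 1) * reg ((i + 1) * t) := by
  obtain ⟨K, hK, hb, -⟩ := exists_reg_bounds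
  have hs : Summable fun j : ℕ => 1 / ((j : ℝ) + 1) ^ 2 := by
    have := (summable_nat_add_iff 1).2 (Real.summable_one_div_nat_pow.2 one_lt_two)
    simpa using this
  refine .of_norm_bounded (hs.mul_left (K / t)) fun i => ?_
  simp only [norm_mul, norm_div, norm_pow, norm_neg, norm_one, one_pow]
  rw [Real.norm_of_nonneg (by positivity)]
  calc _ ≤ 1 / ((i : ℝ) + 1) * (K / ((i + 1) * t)) := by
        gcongr
        exact hb _ (by positivity)
    _ = _ := by field_simp

theorem tendsto_tsum_alternating_reg :
    Tendsto (fun t => ∑' i : ℕ, (-1) ^ i / ((i : ℝ) + 1) * reg ((i + 1) * t)) (𝓝[>] 0)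
      (𝓝 (-3 / 4 * log 2)) := by
  obtain ⟨K, hK, hb, hl⟩ := exists_reg_bounds
  have hbdd : ∀ y > 0, |reg y| ≤ 2 * K := by
    intro y hy
    rcases le_total 1 y with h | h
    · refine (hb y hy).trans ((div_le_self hK.le h).trans (by linarith))
    · have h1 := hl y hy 1 one_pos
      have h2 := hb 1 one_pos
      have h3 : |y - 1| ≤ 1 := by rw [abs_le]; constructor <;> linarith
      have h4 : |reg y| ≤ |reg y - reg 1| + |reg 1| := by
        simpa using abs_add_le (reg y - reg 1) (reg 1)
      rw [div_one] at h2
      nlinarith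
  have heq : ∀ t : ℝ, 0 < t → ∑' k : ℕ, (1 / (2 * (k : ℝ) + 1) * reg ((2 * k + 1) * t) -
      1 / (2 * (k : ℝ) + 2) * reg ((2 * k + 2) * t)) =
      ∑' i : ℕ, (-1) ^ i / ((i : ℝ) + 1) * reg ((i + 1) * t) := by
    intro t ht
    have hs := summable_alternating_reg ht
    obtain ⟨F, hF⟩ : ∃ F : ℕ → ℝ, F = fun i : ℕ => (-1) ^ i / ((i : ℝ) + 1) * reg ((i + 1) * t) :=
      ⟨_, rfl⟩
    rw [← hF] at hs ⊢
    have h0 : Summable fun k => F (2 * k) := hs.comp_injective fun a b hab => by simpa using hab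
    have h1 : Summable fun k => F (2 * k + 1) := hs.comp_injective fun a b hab => by simpa using hab
    rw [← tsum_even_add_odd h0 h1, ← h0.tsum_add h1]
    refine tsum_congr fun k => ?_
    simp only [hF]
    rw [pow_succ, pow_mul]
    push_cast
    simp only [even_two, Even.neg_pow, one_pow]
    rw [show (2 * (k : ℝ) + 1 + 1) = 2 * k + 2 by ring]
    ring
  have hlim : -3 / 4 * log 2 =
      ∑' k : ℕ, (1 / (2 * (k : ℝ) + 1) * (-3 / 4) - 1 / (2 * (k : ℝ) + 2) * (-3 / 4)) := by
    rw [← hasSum_alternating_harmonic.tsum_eq, ← tsum_mul_left]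
    refine tsum_congr fun k => ?_
    ring
  have hsb : Summable fun k : ℕ => 3 * K * (1 / (((k : ℝ) + 1) * √((k : ℝ) + 1))) := by
    have h1 := (summable_nat_add_iff 1).2
      (Real.summable_one_div_nat_rpow.2 (by norm_num : (1 : ℝ) < 3 / 2))
    refine (h1.congr fun k => ?_).mul_left _
    push_cast
    rw [show (3 / 2 : ℝ) = 1 + 1 / 2 by norm_num, rpow_add (by positivity), rpow_one,
      ← sqrt_eq_rpow]
  rw [hlim]
  refine Tendsto.congr' (f₁ := fun t => ∑' k : ℕ, (1 / (2 * (k : ℝ) + 1) * reg ((2 * k + 1) * t) -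
      1 / (2 * (k : ℝ) + 2) * reg ((2 * k + 2) * t))) ?_ ?_
  · filter_upwards [self_mem_nhdsWithin] with t ht using heq t ht
  refine tendsto_tsum_of_dominated_convergence hsb (fun k => ?_) ?_
  · have hmul : ∀ c : ℝ, 0 < c → Tendsto (fun t : ℝ => reg (c * t)) (𝓝[>] 0) (𝓝 (-3 / 4)) := by
      intro c hc
      refine tendsto_reg.comp (tendsto_nhdsWithin_iff.2 ⟨?_, ?_⟩)
      · have : Continuous fun t : ℝ => c * t := by fun_prop
        simpa using this.continuousAt.tendsto.mono_left (nhdsWithin_le_nhds (a := (0 : ℝ)))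
      · filter_upwards [self_mem_nhdsWithin] with t ht using mul_pos hc ht
    exact ((hmul _ (by positivity)).const_mul _).sub ((hmul _ (by positivity)).const_mul _)
  · filter_upwards [self_mem_nhdsWithin] with t ht k
    have ht : 0 < t := ht
    have hk : (0 : ℝ) ≤ k := Nat.cast_nonneg k
    set r := √((k : ℝ) + 1) with hr
    have hr2 : r ^ 2 = k + 1 := sq_sqrt (by positivity)
    have hr1 : 1 ≤ r := by rw [hr, one_le_sqrt]; linarith
    set a := (2 * (k : ℝ) + 1) * t with ha
    set b := (2 * (k : ℝ) + 2) * t with hb'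
    have ha0 : 0 < a := by positivity
    have hb0 : 0 < b := by positivity
    have hdiff : |reg a - reg b| ≤ 2 * K / r := by
      have h1 := hl a ha0 b hb0
      have h2 : |a - b| = t := by
        rw [ha, hb', ← sub_mul, abs_mul, abs_of_pos ht]
        norm_num
      rw [h2] at h1
      have h3 : |reg a - reg b| ≤ K / a + K / b := (abs_sub _ _).trans
        (add_le_add (hb a ha0) (hb b hb0))
      have h4 : K / a + K / b ≤ 2 * K / (r ^ 2 * t) := by
        have h5 : K / a ≤ K / (r ^ 2 * t) := by
          gcongr
          rw [ha, hr2]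
          gcongr
          linarith
        have h6 : K / b ≤ K / (r ^ 2 * t) := by
          gcongr
          rw [hb', hr2]
          gcongr
          · linarith
          · linarith
        rw [two_mul, add_div]
        linarith
      have h7 : |reg a - reg b| ^ 2 ≤ (2 * K / r) ^ 2 := by
        calc |reg a - reg b| ^ 2 = |reg a - reg b| * |reg a - reg b| := sq _
          _ ≤ (K * t) * (2 * K / (r ^ 2 * t)) := by
            gcongr
            exact h3.trans h4
          _ = 2 * K ^ 2 / r ^ 2 := by field_simp
          _ ≤ (2 * K / r) ^ 2 := by
            rw [div_pow, mul_pow]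
            gcongr
            norm_num
      exact le_of_sq_le_sq h7 (by positivity)
    have hsplit : 1 / (2 * (k : ℝ) + 1) * reg a - 1 / (2 * (k : ℝ) + 2) * reg b =
        1 / ((2 * (k : ℝ) + 1) * (2 * k + 2)) * reg a + 1 / (2 * (k : ℝ) + 2) * (reg a - reg b) := by
      field_simp
      ring
    rw [hsplit, Real.norm_eq_abs]
    refine (abs_add_le _ _).trans ?_
    have e3 : (0 : ℝ) < 1 / ((2 * (k : ℝ) + 1) * (2 * k + 2)) := by positivity
    have e4 : (0 : ℝ) < 1 / (2 * (k : ℝ) + 2) := by positivity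
    rw [abs_mul, abs_mul, abs_of_pos e3, abs_of_pos e4]
    have e1 : 1 / ((2 * (k : ℝ) + 1) * (2 * k + 2)) ≤ 1 / ((k + 1) * r) := by
      have : r ≤ k + 1 := by nlinarith
      refine one_div_le_one_div_of_le (by positivity) ?_
      nlinarith
    have e2 : 1 / (2 * (k : ℝ) + 2) = 1 / (2 * (k + 1)) := by ring_nf
    calc _ ≤ 1 / ((k + 1) * r) * (2 * K) + 1 / (2 * ((k : ℝ) + 1)) * (2 * K / r) := by
          rw [e2]
          gcongr
          exact hbdd a ha0
      _ = _ := by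
          field_simp
          ring

/-- The expansion of `logSum` at `0`, up to `o(1)`. -/
noncomputable def logMain (t : ℝ) : ℝ :=
  7 * π ^ 4 / 120 * (1 / t ^ 3) + 9 * realZeta 3 / 4 * (1 / t ^ 2) + π ^ 2 / 12 * (1 / t)
    - 3 / 4 * log 2

theorem tendsto_logSum_sub : Tendsto (fun t => logSum t - logMain t) (𝓝[>] 0) (𝓝 0) := by
  have h := tendsto_tsum_alternating_reg.sub_const (-3 / 4 * log 2)
  rw [sub_self] at h
  refine h.congr' ?_
  filter_upwards [self_mem_nhdsWithin] with t ht
  have ht : 0 < t := ht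
  have s4 := (hasSum_alternating (hasSum_one_div_add_one_pow (by norm_num) hasSum_zeta_four)).mul_left
    (6 / t ^ 3)
  have s3 := (hasSum_alternating
    (hasSum_one_div_add_one_pow (by norm_num) hasSum_realZeta_three)).mul_left (3 / t ^ 2)
  have s2 := (hasSum_alternating (hasSum_one_div_add_one_pow (by norm_num) hasSum_zeta_two)).mul_left
    (1 / t)
  have s := (((summable_alternating_reg ht).hasSum.add s4).add s3).add s2
  have h1 := s.congr_fun (g := fun i : ℕ => (-1) ^ i / ((i : ℝ) + 1) *
    (reg ((i + 1) * t) + 6 / ((i + 1) * t) ^ 3 + 3 / ((i + 1) * t) ^ 2 + 1 / ((i + 1) * t)))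
    fun i => by field_simp
  rw [logSum_eq_tsum ht, h1.tsum_eq, logMain]
  ring

/-! ### Asymptotics of `meanSum` and `varSum` -/

theorem eventually_forall_abs_sub_le {P : ℝ → Prop} (h : ∀ᶠ u in 𝓝[>] 0, P u) :
    ∀ᶠ t in 𝓝[>] (0 : ℝ), ∀ u, |u - t| ≤ t / 2 → P u := by
  obtain ⟨δ, hδ, hP⟩ := mem_nhdsGT_iff_exists_Ioo_subset.1 h
  filter_upwards [Ioo_mem_nhdsGT (half_pos hδ)] with t ht u hu
  have h1 := abs_le.1 hu
  exact hP ⟨by linarith [ht.1], by linarith [ht.2]⟩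

theorem tendsto_self_nhdsGT_zero : Tendsto (fun t : ℝ => t) (𝓝[>] 0) (𝓝 0) :=
  tendsto_nhdsWithin_of_tendsto_nhds tendsto_id

theorem tendsto_sqrt_nhdsGT_zero : Tendsto (fun t : ℝ => √t) (𝓝[>] 0) (𝓝 0) := by
  simpa using (Real.continuous_sqrt.tendsto 0).mono_left nhdsWithin_le_nhds

/-- The expansion of `meanSum` at `0`. -/
noncomputable def meanMain (t : ℝ) : ℝ :=
  7 * π ^ 4 / 40 * (1 / t ^ 4) + 9 * realZeta 3 / 2 * (1 / t ^ 3) + π ^ 2 / 12 * (1 / t ^ 2)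

theorem tendsto_meanSum_sub :
    Tendsto (fun t => t ^ 2 * √t * (meanSum t - meanMain t)) (𝓝[>] 0) (𝓝 0) := by
  have hs : ∀ᶠ t : ℝ in 𝓝[>] 0, 0 < t ^ 2 * √t ∧ t ^ 2 * √t ≤ t / 2 := by
    filter_upwards [Ioo_mem_nhdsGT (show (0 : ℝ) < 1 / 2 by norm_num)] with t ⟨h0, h1⟩
    refine ⟨by positivity, ?_⟩
    have h2 : √t ≤ 1 := sqrt_le_one.2 (by linarith)
    have : t ^ 2 * √t ≤ t ^ 2 * 1 := by gcongr
    nlinarith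
  have hK : 0 ≤ 7 * π ^ 4 / 120 * 22 + |9 * realZeta 3 / 4| * 8 + π ^ 2 / 12 * 2 := by positivity
  have h := tendsto_subgradient (g₀ := logMain) (m₀ := meanMain) (e := fun _ => 1) hK
    (fun t ht u hu => logSum_sub_le ht hu) hs (Eventually.of_forall fun _ => one_pos) ?_ ?_
  · refine h.congr fun t => ?_
    rw [div_one]
  · intro ε hε
    have h1 : ∀ᶠ u in 𝓝[>] 0, |logSum u - logMain u| ≤ ε := by
      have := Metric.tendsto_nhds.1 tendsto_logSum_sub ε hε
      filter_upwards [this] with u hu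
      rw [Real.dist_eq, sub_zero] at hu
      exact hu.le
    filter_upwards [eventually_forall_abs_sub_le h1, hs] with t h2 h3 u hu
    rw [mul_one]
    exact h2 u (hu.trans h3.2)
  · filter_upwards [hs, Ioo_mem_nhdsGT (show (0 : ℝ) < 1 by norm_num)] with t h3 ⟨h0, h1⟩ u hu
    have h4 := abs_le.1 (hu.trans h3.2)
    obtain ⟨e1, e2, e3, -⟩ := abs_inv_sub_inv_add_le h0 (u := u) (by linarith [h4.1])
    have e4 : ((u - t) / (t ^ 2 * √t)) ^ 2 = (u - t) ^ 2 / t ^ 5 := by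
      rw [div_pow, mul_pow, sq_sqrt h0.le]
      ring_nf
    have e5 : logMain u - logMain t + meanMain t * (u - t) =
        7 * π ^ 4 / 120 * (1 / u ^ 3 - 1 / t ^ 3 + 3 / t ^ 4 * (u - t)) +
        9 * realZeta 3 / 4 * (1 / u ^ 2 - 1 / t ^ 2 + 2 / t ^ 3 * (u - t)) +
        π ^ 2 / 12 * (1 / u - 1 / t + 1 / t ^ 2 * (u - t)) := by
      rw [logMain, logMain, meanMain]
      ring
    have e6 : (u - t) ^ 2 / t ^ 4 ≤ (u - t) ^ 2 / t ^ 5 := by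
      refine div_le_div_of_nonneg_left (sq_nonneg _) (by positivity) ?_
      exact pow_le_pow_of_le_one h0.le h1.le (by norm_num)
    have e7 : (u - t) ^ 2 / t ^ 3 ≤ (u - t) ^ 2 / t ^ 5 := by
      refine div_le_div_of_nonneg_left (sq_nonneg _) (by positivity) ?_
      exact pow_le_pow_of_le_one h0.le h1.le (by norm_num)
    rw [e4, e5]
    refine (abs_add_three _ _ _).trans ?_
    rw [abs_mul, abs_mul, abs_mul, abs_of_nonneg (by positivity : 0 ≤ 7 * π ^ 4 / 120),
      abs_of_nonneg (by positivity : 0 ≤ π ^ 2 / 12)]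
    calc _ ≤ 7 * π ^ 4 / 120 * (22 * ((u - t) ^ 2 / t ^ 5)) +
          |9 * realZeta 3 / 4| * (8 * ((u - t) ^ 2 / t ^ 5)) +
          π ^ 2 / 12 * (2 * ((u - t) ^ 2 / t ^ 5)) := by
          gcongr
          · exact e3.trans_eq (by ring)
          · exact e2.trans (by rw [mul_div_assoc]; gcongr)
          · exact e1.trans (by rw [mul_div_assoc]; gcongr)
      _ = _ := by ring

theorem tendsto_pow_mul_meanSum :
    Tendsto (fun t => t ^ 4 * meanSum t) (𝓝[>] 0) (𝓝 (7 * π ^ 4 / 40)) := by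
  have ht := tendsto_self_nhdsGT_zero
  have h := ((((ht.mul tendsto_sqrt_nhdsGT_zero).mul tendsto_meanSum_sub).add_const
    (7 * π ^ 4 / 40)).add (ht.const_mul (9 * realZeta 3 / 2))).add
      ((ht.pow 2).const_mul (π ^ 2 / 12))
  simp only [mul_zero, zero_add, add_zero, ne_eq, OfNat.ofNat_ne_zero, not_false_eq_true,
    zero_pow] at h
  refine h.congr' ?_
  filter_upwards [self_mem_nhdsWithin] with t ht
  have ht : 0 < t := ht
  have h1 : t * √t * (t ^ 2 * √t * (meanSum t - meanMain t)) =
      t ^ 4 * (meanSum t - meanMain t) := by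
    calc _ = t ^ 3 * √t ^ 2 * (meanSum t - meanMain t) := by ring
      _ = _ := by rw [sq_sqrt ht.le]; ring
  rw [h1, meanMain]
  field_simp
  ring

theorem tendsto_pow_mul_varSum :
    Tendsto (fun t => t ^ 5 * varSum t) (𝓝[>] 0) (𝓝 (7 * π ^ 4 / 10)) := by
  have hA : 0 ≤ 7 * π ^ 4 / 40 * 13 := by positivity
  have h := tendsto_subgradient (s := fun t => t / 2) (e := fun t => 1 / t ^ 4)
    (g₀ := fun t => 7 * π ^ 4 / 40 * (1 / t ^ 4)) (m₀ := fun t => 7 * π ^ 4 / 10 * (1 / t ^ 5)) hA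
    (fun t ht u hu => meanSum_sub_le ht hu) ?_ ?_ ?_ ?_
  · have h1 := (h.const_mul 2).add_const (7 * π ^ 4 / 10)
    rw [mul_zero, zero_add] at h1
    refine h1.congr' ?_
    filter_upwards [self_mem_nhdsWithin] with t ht
    have ht : 0 < t := ht
    field_simp
    ring
  · filter_upwards [self_mem_nhdsWithin] with t ht using ⟨half_pos ht, le_rfl⟩
  · filter_upwards [self_mem_nhdsWithin] with t ht
    have ht : 0 < t := ht
    positivity
  · intro ε hε
    have h1 : ∀ᶠ u in 𝓝[>] 0, |u ^ 4 * meanSum u - 7 * π ^ 4 / 40| < ε / 16 := by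
      have := Metric.tendsto_nhds.1 tendsto_pow_mul_meanSum (ε / 16) (by positivity)
      simpa only [Real.dist_eq] using this
    filter_upwards [eventually_forall_abs_sub_le h1, self_mem_nhdsWithin] with t h2 ht u hu
    have ht : 0 < t := ht
    have hu2 : t / 2 ≤ u := by linarith [(abs_le.1 hu).1]
    have hu0 : 0 < u := by linarith
    have h3 : meanSum u - 7 * π ^ 4 / 40 * (1 / u ^ 4) =
        (u ^ 4 * meanSum u - 7 * π ^ 4 / 40) / u ^ 4 := by field_simp
    rw [h3, abs_div, abs_of_pos (by positivity : 0 < u ^ 4)]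
    calc _ ≤ ε / 16 / (t / 2) ^ 4 := by
          gcongr
          exact (h2 u hu).le
      _ = _ := by field_simp; norm_num
  · filter_upwards [self_mem_nhdsWithin] with t ht u hu
    have ht : 0 < t := ht
    have hu2 : t / 2 ≤ u := by linarith [(abs_le.1 hu).1]
    obtain ⟨-, -, -, e4⟩ := abs_inv_sub_inv_add_le ht hu2
    have e5 : 7 * π ^ 4 / 40 * (1 / u ^ 4) - 7 * π ^ 4 / 40 * (1 / t ^ 4) +
        7 * π ^ 4 / 10 * (1 / t ^ 5) * (u - t) =
        7 * π ^ 4 / 40 * (1 / u ^ 4 - 1 / t ^ 4 + 4 / t ^ 5 * (u - t)) := by ring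
    rw [e5, abs_mul, abs_of_nonneg (by positivity : 0 ≤ 7 * π ^ 4 / 40)]
    calc _ ≤ 7 * π ^ 4 / 40 * (52 * (u - t) ^ 2 / t ^ 6) := by gcongr
      _ = _ := by field_simp; ring

/-! ### Bernoulli characteristic functions -/

/-- The characteristic function of a Bernoulli variable of parameter `p`. -/
noncomputable def bernoulliChar (p α : ℝ) : ℂ := 1 - p + p * Complex.exp (α * Complex.I)

theorem norm_exp_mul_I_sub_le (x : ℝ) :
    ‖Complex.exp (x * Complex.I) - (1 + x * Complex.I - x ^ 2 / 2)‖ ≤ 4 * |x| ^ 3 := by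
  have hI : ‖(x : ℂ) * Complex.I‖ = |x| := by simp
  rcases le_total |x| 1 with h | h
  · have h1 := Complex.norm_exp_sub_sum_le_norm_mul_exp (x * Complex.I) 3
    rw [hI] at h1
    have h2 : ∑ m ∈ Finset.range 3, ((x : ℂ) * Complex.I) ^ m / (m.factorial : ℂ) =
        1 + x * Complex.I - x ^ 2 / 2 := by
      simp only [Finset.sum_range_succ, Finset.sum_range_zero, mul_pow, Complex.I_sq]
      simp [Nat.factorial]
      ring
    rw [h2] at h1
    have h3 : exp |x| ≤ 4 := by
      have h4 : exp |x| ≤ exp 1 := exp_le_exp.2 h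
      linarith [Real.exp_one_lt_d9]
    calc _ ≤ |x| ^ 3 * exp |x| := h1
      _ ≤ |x| ^ 3 * 4 := by gcongr
      _ = _ := by ring
  · have h1 : ‖(1 : ℂ) + x * Complex.I - x ^ 2 / 2‖ ≤ 1 + |x| + |x| ^ 2 / 2 := by
      refine (norm_sub_le _ _).trans (add_le_add ((norm_add_le _ _).trans ?_) ?_)
      · rw [hI, norm_one]
      · simp
    have h2 := norm_sub_le (Complex.exp (x * Complex.I)) (1 + x * Complex.I - x ^ 2 / 2)
    rw [Complex.norm_exp_ofReal_mul_I] at h2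
    nlinarith [sq_nonneg (|x|), mul_nonneg (sub_nonneg.2 h) (sq_nonneg |x|),
      mul_nonneg (sub_nonneg.2 h) (abs_nonneg x)]

theorem norm_bernoulliChar_mul_exp_sub_le {p : ℝ} (hp0 : 0 ≤ p) (hp1 : p ≤ 1) (α : ℝ) :
    ‖bernoulliChar p α * Complex.exp (-(p * α * Complex.I)) -
      (exp (-(p * (1 - p) * α ^ 2 / 2)) : ℝ)‖ ≤ 4 * p * (|α| ^ 3 + |α| ^ 4) := by
  have hq0 : 0 ≤ 1 - p := sub_nonneg.2 hp1
  have h1 := norm_exp_mul_I_sub_le (-(p * α))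
  have h2 := norm_exp_mul_I_sub_le ((1 - p) * α)
  set u := p * (1 - p) * α ^ 2 / 2 with hu
  have hu0 : 0 ≤ u := by positivity
  have h3 : |exp (-u) - (1 - u)| ≤ p * |α| ^ 4 := by
    have h4 : exp (-u) ≤ 1 - u + u ^ 2 := by
      rcases le_total u 1 with h | h
      · have := Real.abs_exp_sub_one_sub_id_le (x := -u) (by rwa [abs_neg, abs_of_nonneg hu0])
        have := (abs_le.1 this).2
        linarith [neg_sq u]
      · have : exp (-u) ≤ 1 := exp_le_one_iff.2 (by linarith)
        nlinarith
    have h5 := one_sub_le_exp_neg u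
    rw [abs_of_nonneg (by linarith)]
    have h6 : u ^ 2 ≤ p * |α| ^ 4 := by
      have h7 : |α| ^ 4 = α ^ 4 := Even.pow_abs (by decide) α
      have h8 : u ^ 2 = p * α ^ 4 * (p * (1 - p) ^ 2 / 4) := by rw [hu]; ring
      rw [h7, h8]
      refine mul_le_of_le_one_right (by positivity) ?_
      have : p * (1 - p) ^ 2 ≤ 1 * 1 := by
        gcongr
        exact pow_le_one₀ hq0 (by linarith)
      linarith
    linarith
  have h4 : bernoulliChar p α * Complex.exp (-(p * α * Complex.I)) - (exp (-u) : ℝ) =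
      (1 - p : ℝ) * (Complex.exp ((-(p * α) : ℝ) * Complex.I) -
        (1 + (-(p * α) : ℝ) * Complex.I - (-(p * α) : ℝ) ^ 2 / 2)) +
      (p : ℝ) * (Complex.exp (((1 - p) * α : ℝ) * Complex.I) -
        (1 + ((1 - p) * α : ℝ) * Complex.I - ((1 - p) * α : ℝ) ^ 2 / 2)) -
      ((exp (-u) - (1 - u) : ℝ) : ℂ) := by
    have h5 : Complex.exp (((1 - p) * α : ℝ) * Complex.I) =
        Complex.exp (α * Complex.I) * Complex.exp (-(p * α * Complex.I)) := by
      rw [← Complex.exp_add]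
      congr 1
      push_cast
      ring
    have h6 : Complex.exp ((-(p * α) : ℝ) * Complex.I) = Complex.exp (-(p * α * Complex.I)) := by
      congr 1
      push_cast
      ring
    rw [h5, h6, bernoulliChar, hu]
    push_cast
    ring
  rw [h4]
  refine (norm_sub_le _ _).trans ?_
  rw [Complex.norm_real, Real.norm_eq_abs]
  have h5 : ‖(1 - p : ℝ) * (Complex.exp ((-(p * α) : ℝ) * Complex.I) -
        (1 + (-(p * α) : ℝ) * Complex.I - (-(p * α) : ℝ) ^ 2 / 2))‖ ≤
        (1 - p) * (4 * |-(p * α)| ^ 3) := by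
    rw [norm_mul, Complex.norm_real, Real.norm_of_nonneg hq0]
    gcongr
  have h6 : ‖(p : ℝ) * (Complex.exp (((1 - p) * α : ℝ) * Complex.I) -
        (1 + ((1 - p) * α : ℝ) * Complex.I - ((1 - p) * α : ℝ) ^ 2 / 2))‖ ≤
        p * (4 * |(1 - p) * α| ^ 3) := by
    rw [norm_mul, Complex.norm_real, Real.norm_of_nonneg hp0]
    gcongr
  have h7 : (1 - p) * (4 * |-(p * α)| ^ 3) + p * (4 * |(1 - p) * α| ^ 3) ≤ 4 * p * |α| ^ 3 := by
    rw [abs_neg, abs_mul, abs_mul, abs_of_nonneg hp0, abs_of_nonneg hq0]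
    have h8 : (1 - p) * p ^ 2 + (1 - p) ^ 3 ≤ 1 := by nlinarith [mul_nonneg hp0 hq0]
    calc _ = 4 * p * |α| ^ 3 * ((1 - p) * p ^ 2 + (1 - p) ^ 3) := by ring
      _ ≤ _ := mul_le_of_le_one_right (by positivity) h8
  have h8 : 0 ≤ p * |α| ^ 4 := by positivity
  refine (add_le_add ((norm_add_le _ _).trans (add_le_add h5 h6)) h3).trans ?_
  linarith

theorem norm_bernoulliChar_le (p α : ℝ) :
    ‖bernoulliChar p α‖ ≤ exp (-(p * (1 - p) * (1 - cos α))) := by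
  have h1 : ‖bernoulliChar p α‖ ^ 2 = 1 - 2 * (p * (1 - p) * (1 - cos α)) := by
    have h2 : bernoulliChar p α = ((1 - p + p * cos α : ℝ) : ℂ) + (p * sin α : ℝ) * Complex.I := by
      rw [bernoulliChar, Complex.exp_mul_I]
      push_cast
      ring
    rw [← Complex.normSq_eq_norm_sq, h2, Complex.normSq_add_mul_I]
    have := sin_sq_add_cos_sq α
    linear_combination p ^ 2 * this
  refine le_of_sq_le_sq ?_ (exp_pos _).le
  rw [h1, ← Real.exp_nat_mul]
  refine (one_sub_le_exp_neg _).trans_eq ?_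
  congr 1
  push_cast
  ring

theorem norm_bernoulliChar_le_one {p : ℝ} (hp0 : 0 ≤ p) (hp1 : p ≤ 1) (α : ℝ) :
    ‖bernoulliChar p α‖ ≤ 1 := by
  refine (norm_bernoulliChar_le p α).trans (exp_le_one_iff.2 ?_)
  have := mul_nonneg (mul_nonneg hp0 (sub_nonneg.2 hp1)) (sub_nonneg.2 (cos_le_one α))
  linarith

theorem norm_pow_sub_pow_le {a b : ℂ} (ha : ‖a‖ ≤ 1) (hb : ‖b‖ ≤ 1) (m : ℕ) :
    ‖a ^ m - b ^ m‖ ≤ m * ‖a - b‖ := by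
  induction m with
  | zero => simp
  | succ m ih =>
    have h : a ^ (m + 1) - b ^ (m + 1) = (a ^ m - b ^ m) * a + b ^ m * (a - b) := by ring
    rw [h]
    refine (norm_add_le _ _).trans ?_
    rw [norm_mul, norm_mul, norm_pow]
    push_cast
    have h1 : ‖a ^ m - b ^ m‖ * ‖a‖ ≤ m * ‖a - b‖ :=
      (mul_le_of_le_one_right (norm_nonneg _) ha).trans ih
    have h2 : ‖b‖ ^ m * ‖a - b‖ ≤ ‖a - b‖ :=
      mul_le_of_le_one_left (norm_nonneg _) (pow_le_one₀ (norm_nonneg _) hb)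
    linarith

theorem norm_prod_pow_sub_prod_pow_le {a b : ℕ → ℂ} (ha : ∀ j, ‖a j‖ ≤ 1) (hb : ∀ j, ‖b j‖ ≤ 1)
    (m : ℕ → ℕ) (N : ℕ) :
    ‖∏ j ∈ Finset.range N, a j ^ m j - ∏ j ∈ Finset.range N, b j ^ m j‖ ≤
      ∑ j ∈ Finset.range N, m j * ‖a j - b j‖ := by
  induction N with
  | zero => simp
  | succ N ih =>
    rw [Finset.prod_range_succ, Finset.prod_range_succ, Finset.sum_range_succ]
    have h : ∀ A B x y : ℂ, A * x - B * y = (A - B) * x + B * (x - y) := fun A B x y => by ring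
    rw [h]
    refine (norm_add_le _ _).trans ?_
    rw [norm_mul, norm_mul]
    have h1 : ‖a N ^ m N‖ ≤ 1 := by
      rw [norm_pow]
      exact pow_le_one₀ (norm_nonneg _) (ha N)
    have h2 : ‖∏ j ∈ Finset.range N, b j ^ m j‖ ≤ 1 := by
      rw [norm_prod]
      refine Finset.prod_le_one (fun j _ => norm_nonneg _) fun j _ => ?_
      rw [norm_pow]
      exact pow_le_one₀ (norm_nonneg _) (hb j)
    refine add_le_add ((mul_le_of_le_one_right (norm_nonneg _) h1).trans ih)
      ((mul_le_of_le_one_left (norm_nonneg _) h2).trans (norm_pow_sub_pow_le (ha N) (hb N) _))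

/-! ### The characteristic function of the tilted partition -/

/-- The characteristic function of the truncated random partition with parameter `e ^ (-t)`. -/
noncomputable def tiltedChar (N : ℕ) (t θ : ℝ) : ℂ :=
  ∏ j ∈ Finset.range N, bernoulliChar (fermi ((j + 1) * t)) ((j + 1) * θ) ^ mult j

theorem one_add_exp_eq (j : ℕ) (t θ : ℝ) :
    1 + Complex.exp (((j : ℂ) + 1) * (-t + θ * Complex.I)) =
      Complex.exp (log (1 + exp (-((j + 1) * t))) : ℝ) *
        bernoulliChar (fermi ((j + 1) * t)) ((j + 1) * θ) := by
  have h0 : 0 < 1 + exp (-((j + 1) * t)) := by positivity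
  have h2 : Complex.exp (((j : ℂ) + 1) * (-t + θ * Complex.I)) =
      (exp (-((j + 1) * t)) : ℝ) * Complex.exp (((j + 1) * θ : ℝ) * Complex.I) := by
    rw [Complex.ofReal_exp, ← Complex.exp_add]
    congr 1
    push_cast
    ring
  rw [h2, ← Complex.ofReal_exp, exp_log h0, bernoulliChar, ← Complex.ofReal_one,
    ← Complex.ofReal_sub, one_sub_fermi, fermi_eq, mul_add, ← mul_assoc, ← Complex.ofReal_mul,
    ← Complex.ofReal_mul, mul_one_div_cancel h0.ne', mul_div_cancel₀ _ h0.ne']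

theorem qk_eq_integral_tiltedChar (n N : ℕ) (hN : n ≤ N) (t : ℝ) :
    (2 * π : ℂ) * (qk (1 / 3) n : ℂ) =
      (exp (n * t + ∑ j ∈ Finset.range N, (mult j : ℝ) * log (1 + exp (-((j + 1) * t)))) : ℝ) *
        ∫ θ in (-π)..π, Complex.exp (-(n * θ * Complex.I)) * tiltedChar N t θ := by
  rw [qk_eq_integral n N hN t, exp_add, Complex.ofReal_mul, mul_assoc]
  congr 1
  · push_cast
    rfl
  · rw [← intervalIntegral.integral_const_mul]
    congr 1
    ext θ
    rw [mul_left_comm]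
    congr 1
    rw [tiltedChar, Complex.ofReal_exp, Complex.ofReal_sum, Complex.exp_sum, ← Finset.prod_mul_distrib]
    refine Finset.prod_congr rfl fun j _ => ?_
    rw [one_add_exp_eq, mul_pow, ← Complex.exp_nat_mul]
    push_cast
    rfl

theorem exists_norm_tiltedChar_sub_le :
    ∃ K, ∀ t > 0, ∀ (N : ℕ) (θ : ℝ),
      ‖tiltedChar N t θ * Complex.exp (-((∑ j ∈ Finset.range N,
          (mult j : ℝ) * ((j + 1) * fermi ((j + 1) * t)) : ℝ) * θ * Complex.I)) -
        (exp (-((∑ j ∈ Finset.range N, (mult j : ℝ) *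
          ((j + 1) ^ 2 * (fermi ((j + 1) * t) * (1 - fermi ((j + 1) * t))))) * θ ^ 2 / 2)) : ℝ)‖ ≤
        K * (|θ| ^ 3 / t ^ 7 + |θ| ^ 4 / t ^ 8) := by
  obtain ⟨K₃, hK₃⟩ := sum_mult_mul_pow_mul_exp_le 3
  obtain ⟨K₄, hK₄⟩ := sum_mult_mul_pow_mul_exp_le 4
  refine ⟨4 * max K₃ K₄, fun t ht N θ => ?_⟩
  set p : ℕ → ℝ := fun j => fermi ((j + 1) * t) with hp
  have hp0 : ∀ j, 0 ≤ p j := fun j => (fermi_pos _).le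
  have hp1 : ∀ j, p j ≤ 1 := fun j => (fermi_lt_one _).le
  set a : ℕ → ℂ := fun j => bernoulliChar (p j) ((j + 1) * θ) *
    Complex.exp (-(p j * ((j + 1) * θ : ℝ) * Complex.I)) with ha
  set b : ℕ → ℂ := fun j => (exp (-(p j * (1 - p j) * ((j + 1) * θ) ^ 2 / 2)) : ℝ) with hb
  have ha1 : ∀ j, ‖a j‖ ≤ 1 := by
    intro j
    have h1 : -((p j : ℂ) * ((j + 1) * θ : ℝ) * Complex.I) =
        ((-(p j * ((j + 1) * θ)) : ℝ) : ℂ) * Complex.I := by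
      push_cast
      ring
    rw [ha]
    simp only
    rw [norm_mul, h1, Complex.norm_exp_ofReal_mul_I, mul_one]
    exact norm_bernoulliChar_le_one (hp0 j) (hp1 j) _
  have hb1 : ∀ j, ‖b j‖ ≤ 1 := by
    intro j
    rw [hb]
    simp only
    rw [Complex.norm_real, Real.norm_of_nonneg (exp_pos _).le, exp_le_one_iff]
    have := mul_nonneg (mul_nonneg (hp0 j) (sub_nonneg.2 (hp1 j))) (sq_nonneg (((j : ℝ) + 1) * θ))
    linarith
  have hab : ∀ j : ℕ, (mult j : ℝ) * ‖a j - b j‖ ≤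
      4 * |θ| ^ 3 * (mult j * (((j : ℝ) + 1) ^ 3 * exp (-((j + 1) * t)))) +
      4 * |θ| ^ 4 * (mult j * (((j : ℝ) + 1) ^ 4 * exp (-((j + 1) * t)))) := by
    intro j
    have h1 := norm_bernoulliChar_mul_exp_sub_le (hp0 j) (hp1 j) ((j + 1) * θ)
    have h2 : p j ≤ exp (-((j + 1) * t)) := fermi_le_exp_neg _
    have h3 : |((j : ℝ) + 1) * θ| = (j + 1) * |θ| := by
      rw [abs_mul, abs_of_pos (by positivity)]
    calc _ ≤ (mult j : ℝ) * (4 * p j * (|((j : ℝ) + 1) * θ| ^ 3 + |((j : ℝ) + 1) * θ| ^ 4)) := by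
          gcongr
      _ ≤ (mult j : ℝ) * (4 * exp (-((j + 1) * t)) *
            (|((j : ℝ) + 1) * θ| ^ 3 + |((j : ℝ) + 1) * θ| ^ 4)) := by gcongr
      _ = _ := by
          rw [h3]
          ring
  have hA : tiltedChar N t θ * Complex.exp (-((∑ j ∈ Finset.range N,
      (mult j : ℝ) * ((j + 1) * p j) : ℝ) * θ * Complex.I)) =
      ∏ j ∈ Finset.range N, a j ^ mult j := by
    have h1 : -(((∑ j ∈ Finset.range N, (mult j : ℝ) * ((j + 1) * p j) : ℝ) : ℂ) * θ * Complex.I) =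
        ∑ j ∈ Finset.range N, (mult j : ℂ) * -((p j : ℂ) * ((j + 1) * θ : ℝ) * Complex.I) := by
      rw [Complex.ofReal_sum, Finset.sum_mul, Finset.sum_mul, ← Finset.sum_neg_distrib]
      refine Finset.sum_congr rfl fun j _ => ?_
      push_cast
      ring
    rw [tiltedChar, h1, Complex.exp_sum, ← Finset.prod_mul_distrib]
    refine Finset.prod_congr rfl fun j _ => ?_
    rw [Complex.exp_nat_mul, ← mul_pow]
  have hB : ((exp (-((∑ j ∈ Finset.range N, (mult j : ℝ) *
      ((j + 1) ^ 2 * (p j * (1 - p j)))) * θ ^ 2 / 2)) : ℝ) : ℂ) =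
      ∏ j ∈ Finset.range N, b j ^ mult j := by
    have h1 : -((∑ j ∈ Finset.range N, (mult j : ℝ) *
        ((j + 1) ^ 2 * (p j * (1 - p j)))) * θ ^ 2 / 2) =
        ∑ j ∈ Finset.range N, (mult j : ℝ) * -(p j * (1 - p j) * ((j + 1) * θ) ^ 2 / 2) := by
      rw [Finset.sum_mul, Finset.sum_div, ← Finset.sum_neg_distrib]
      refine Finset.sum_congr rfl fun j _ => ?_
      ring
    rw [h1, Real.exp_sum, Complex.ofReal_prod]
    refine Finset.prod_congr rfl fun j _ => ?_
    rw [Real.exp_nat_mul, Complex.ofReal_pow]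
  rw [hA, hB]
  refine (norm_prod_pow_sub_prod_pow_le ha1 hb1 mult N).trans ?_
  calc _ ≤ ∑ j ∈ Finset.range N,
        (4 * |θ| ^ 3 * (mult j * (((j : ℝ) + 1) ^ 3 * exp (-((j + 1) * t)))) +
        4 * |θ| ^ 4 * (mult j * (((j : ℝ) + 1) ^ 4 * exp (-((j + 1) * t))))) :=
        Finset.sum_le_sum fun j _ => hab j
    _ ≤ 4 * |θ| ^ 3 * (max K₃ K₄ / t ^ 7) + 4 * |θ| ^ 4 * (max K₃ K₄ / t ^ 8) := by
        rw [Finset.sum_add_distrib, ← Finset.mul_sum, ← Finset.mul_sum]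
        gcongr
        · refine (hK₃ t ht N).trans ?_
          gcongr
          exact le_max_left _ _
        · refine (hK₄ t ht N).trans ?_
          gcongr
          exact le_max_right _ _
    _ = _ := by ring

theorem mul_sin_half_mul_sum_cos (θ : ℝ) (M : ℕ) :
    2 * sin (θ / 2) * ∑ j ∈ Finset.range M, cos ((j + 1) * θ) =
      sin ((M + 1 / 2) * θ) - sin (θ / 2) := by
  induction M with
  | zero =>
    simp only [Finset.range_zero, Finset.sum_empty, mul_zero, Nat.cast_zero, zero_add]
    rw [one_div_mul_eq_div, sub_self]
  | succ M ih =>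
    rw [Finset.sum_range_succ, mul_add, ih]
    push_cast
    have h1 : ((M : ℝ) + 1 + 1 / 2) * θ = (M + 1) * θ + θ / 2 := by ring
    have h2 : ((M : ℝ) + 1 / 2) * θ = (M + 1) * θ - θ / 2 := by ring
    rw [h1, h2, sin_add, sin_sub]
    ring

theorem sum_cos_le {θ : ℝ} (h0 : 0 < θ) (hπ : θ ≤ π) (M : ℕ) :
    ∑ j ∈ Finset.range M, cos ((j + 1) * θ) ≤ π / (2 * θ) := by
  have h1 := mul_sin_half_mul_sum_cos θ M
  have h2 : θ / π ≤ sin (θ / 2) := by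
    have := mul_le_sin (x := θ / 2) (by positivity) (by linarith)
    calc θ / π = 2 / π * (θ / 2) := by ring
      _ ≤ _ := this
  have h3 : 0 < θ / π := by positivity
  have h4 : 2 * sin (θ / 2) * ∑ j ∈ Finset.range M, cos ((j + 1) * θ) ≤ 1 := by
    rw [h1]
    linarith [sin_le_one ((M + 1 / 2) * θ)]
  have h5 : π / (2 * θ) = 1 / (2 * (θ / π)) := by field_simp
  rw [h5, le_div_iff₀ (by positivity)]
  rcases le_total 0 (∑ j ∈ Finset.range M, cos ((j + 1) * θ)) with h | h
  · nlinarith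
  · nlinarith

theorem norm_tiltedChar_le {N M : ℕ} (hM : M ≤ N) {t : ℝ} (ht : 0 < t) (hMt : M * t ≤ 4) (θ : ℝ) :
    ‖tiltedChar N t θ‖ ≤ exp (-(exp (-4) / 4 *
      ∑ j ∈ Finset.range M, (mult j : ℝ) * (1 - cos ((j + 1) * θ)))) := by
  have h1 : ‖tiltedChar N t θ‖ ≤ exp (-∑ j ∈ Finset.range N, (mult j : ℝ) *
      (fermi ((j + 1) * t) * (1 - fermi ((j + 1) * t)) * (1 - cos ((j + 1) * θ)))) := by
    rw [tiltedChar, norm_prod, ← Finset.sum_neg_distrib, Real.exp_sum]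
    refine Finset.prod_le_prod (fun _ _ => norm_nonneg _) fun j _ => ?_
    rw [norm_pow, ← mul_neg, Real.exp_nat_mul]
    gcongr
    exact norm_bernoulliChar_le _ _
  refine h1.trans ?_
  rw [exp_le_exp, neg_le_neg_iff, Finset.mul_sum]
  have h2 : ∀ j : ℕ, 0 ≤ 1 - cos ((j + 1) * θ) := fun j => sub_nonneg.2 (cos_le_one _)
  have h3 : ∀ j : ℕ, 0 ≤ fermi ((j + 1) * t) * (1 - fermi ((j + 1) * t)) := fun j =>
    mul_nonneg (fermi_pos _).le (sub_nonneg.2 (fermi_lt_one _).le)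
  refine (Finset.sum_le_sum fun j hj => ?_).trans (Finset.sum_le_sum_of_subset_of_nonneg
    (Finset.range_mono hM) fun j _ _ =>
      mul_nonneg (Nat.cast_nonneg _) (mul_nonneg (h3 j) (h2 j)))
  have h4 : ((j : ℝ) + 1) * t ≤ 4 := by
    have : (j : ℝ) + 1 ≤ M := by exact_mod_cast Finset.mem_range.1 hj
    exact (mul_le_mul_of_nonneg_right this ht.le).trans hMt
  have h5 : exp (-4) / 4 ≤ fermi ((j + 1) * t) * (1 - fermi ((j + 1) * t)) := by
    have hy : 0 ≤ ((j : ℝ) + 1) * t := by positivity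
    generalize ((j : ℝ) + 1) * t = y at h4 hy
    have e1 : exp (-4) ≤ exp (-y) := exp_le_exp.2 (by linarith)
    have e2 : exp (-y) ≤ 1 := exp_le_one_iff.2 (by linarith)
    have e3 := exp_pos (-y)
    rw [one_sub_fermi, fermi_eq, div_mul_div_comm, mul_one]
    refine div_le_div₀ e3.le e1 (by positivity) ?_
    nlinarith
  calc _ = (mult j : ℝ) * (exp (-4) / 4 * (1 - cos ((j + 1) * θ))) := by ring
    _ ≤ _ := by
      gcongr
      exact h2 j

/-! ### The local limit theorem -/

theorem pow_five_div_five_le_sum (M : ℕ) :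
    (M : ℝ) ^ 5 / 5 ≤ ∑ j ∈ Finset.range M, ((j : ℝ) + 1) ^ 4 := by
  induction M with
  | zero => simp
  | succ M ih =>
    rw [Finset.sum_range_succ]
    push_cast
    have : (0 : ℝ) ≤ M := Nat.cast_nonneg M
    have h : ((M : ℝ) + 1) ^ 4 + M ^ 5 / 5 - (M + 1) ^ 5 / 5 =
      2 * M ^ 3 + 4 * M ^ 2 + 3 * M + 4 / 5 := by ring
    have h2 : 0 ≤ 2 * (M : ℝ) ^ 3 + 4 * M ^ 2 + 3 * M + 4 / 5 := by positivity
    linarith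

theorem le_sum_one_sub_cos_of_abs_le {t θ : ℝ} (ht : 0 < t) (ht1 : t ≤ 1 / 2) (hθ : |θ| ≤ t) :
    3 / (80 * π ^ 2) * (θ ^ 2 / t ^ 5) ≤
      ∑ j ∈ Finset.range ⌊1 / t⌋₊, (mult j : ℝ) * (1 - cos ((j + 1) * θ)) := by
  have hM1 : (⌊1 / t⌋₊ : ℝ) ≤ 1 / t := Nat.floor_le (by positivity)
  have hM2 : 1 / t < ⌊1 / t⌋₊ + 1 := Nat.lt_floor_add_one _
  set M := ⌊1 / t⌋₊
  have hM3 : 1 / (2 * t) ≤ M := by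
    have h1 : 2 ≤ 1 / t := by
      rw [le_div_iff₀ ht]
      linarith
    have h2 : 1 / (2 * t) = 1 / t / 2 := by field_simp
    rw [h2]
    linarith
  have hterm : ∀ j ∈ Finset.range M, 6 / π ^ 2 * θ ^ 2 * ((j : ℝ) + 1) ^ 4 ≤
      (mult j : ℝ) * (1 - cos ((j + 1) * θ)) := by
    intro j hj
    have hj1 : (j : ℝ) + 1 ≤ M := by exact_mod_cast Finset.mem_range.1 hj
    have h1 : |((j : ℝ) + 1) * θ| ≤ π := by
      rw [abs_mul, abs_of_pos (by positivity)]
      calc ((j : ℝ) + 1) * |θ| ≤ 1 / t * t := by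
            gcongr
            exact hj1.trans hM1
        _ = 1 := by field_simp
        _ ≤ π := by linarith [pi_gt_three]
    have h2 := Real.cos_le_one_sub_mul_cos_sq h1
    have h3 : 3 * ((j : ℝ) + 1) ^ 2 ≤ mult j := by
      rw [mult]
      push_cast
      nlinarith [(Nat.cast_nonneg j : (0 : ℝ) ≤ j)]
    calc _ = 3 * ((j : ℝ) + 1) ^ 2 * (2 / π ^ 2 * (((j : ℝ) + 1) * θ) ^ 2) := by ring
      _ ≤ _ := by
        gcongr
        linarith
  refine le_trans ?_ (Finset.sum_le_sum hterm)
  rw [← Finset.mul_sum]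
  calc 3 / (80 * π ^ 2) * (θ ^ 2 / t ^ 5) = 6 / π ^ 2 * θ ^ 2 * ((1 / (2 * t)) ^ 5 / 5) := by
        field_simp
        ring
    _ ≤ 6 / π ^ 2 * θ ^ 2 * ((M : ℝ) ^ 5 / 5) := by gcongr
    _ ≤ _ := by
        gcongr
        exact pow_five_div_five_le_sum M

theorem le_sum_one_sub_cos_of_lt_abs {t θ : ℝ} (ht : 0 < t) (ht1 : t ≤ 1 / 2) (hθ : t < |θ|)
    (hθπ : |θ| ≤ π) :
    1 / t ≤ ∑ j ∈ Finset.range ⌊4 / t⌋₊, (mult j : ℝ) * (1 - cos ((j + 1) * θ)) := by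
  have hM2 : 4 / t < ⌊4 / t⌋₊ + 1 := Nat.lt_floor_add_one _
  set M := ⌊4 / t⌋₊
  have hθ0 := ht.trans hθ
  have h1 := sum_cos_le hθ0 hθπ M
  have h2 : π / (2 * |θ|) ≤ 2 / t := by
    rw [div_le_div_iff₀ (by positivity) ht]
    nlinarith [pi_lt_four, pi_pos]
  have h3 : ∀ j ∈ Finset.range M, 1 - cos (((j : ℝ) + 1) * |θ|) ≤
      (mult j : ℝ) * (1 - cos ((j + 1) * θ)) := by
    intro j _
    have h4 : cos (((j : ℝ) + 1) * |θ|) = cos ((j + 1) * θ) := by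
      rw [← cos_abs (((j : ℝ) + 1) * θ), abs_mul, abs_of_pos (by positivity : (0 : ℝ) < j + 1)]
    rw [h4]
    refine le_mul_of_one_le_left (sub_nonneg.2 (cos_le_one _)) ?_
    rw [mult]
    push_cast
    have : (0 : ℝ) ≤ 3 * (j + 1) ^ 2 + 3 * (j + 1) := by positivity
    linarith
  refine le_trans ?_ (Finset.sum_le_sum h3)
  rw [Finset.sum_sub_distrib, Finset.sum_const, Finset.card_range, nsmul_eq_mul, mul_one]
  have h4 : 1 ≤ 1 / t := by
    rw [le_div_iff₀ ht]
    linarith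
  have h5 : 4 / t = 4 * (1 / t) := by ring
  have h6 : 2 / t = 2 * (1 / t) := by ring
  linarith

theorem exists_norm_tiltedChar_le :
    ∃ c > 0, ∃ K, ∀ t : ℝ, 0 < t → t ≤ 1 / 2 → ∀ N : ℕ, 4 ≤ N * t → ∀ x : ℝ,
      |x * (t ^ 2 * √t)| ≤ π →
      ‖tiltedChar N t (x * (t ^ 2 * √t))‖ ≤ exp (-c * x ^ 2) + K * (1 + x ^ 2)⁻¹ := by
  have hκ : 0 < exp (-4) / 4 := by positivity
  set κ := exp (-4) / 4 with hκ'
  refine ⟨κ * (3 / (80 * π ^ 2)), by positivity, 120 / κ ^ 5 * 17, fun t ht ht1 N hN x hx => ?_⟩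
  have hsq : (x * (t ^ 2 * √t)) ^ 2 = x ^ 2 * t ^ 5 := by
    rw [mul_pow, mul_pow, sq_sqrt ht.le]
    ring
  have hNt : 4 / t ≤ N := by rwa [div_le_iff₀ ht]
  rcases le_or_gt |x * (t ^ 2 * √t)| t with h | h
  · have h1 := le_sum_one_sub_cos_of_abs_le ht ht1 h
    have hM1 : (⌊1 / t⌋₊ : ℝ) ≤ 1 / t := Nat.floor_le (by positivity)
    have hMN : ⌊1 / t⌋₊ ≤ N := by
      have h2 : 1 / t ≤ 4 / t := by gcongr; norm_num
      exact_mod_cast hM1.trans (h2.trans hNt)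
    have hMt : (⌊1 / t⌋₊ : ℝ) * t ≤ 4 := by
      calc _ ≤ 1 / t * t := by gcongr
        _ = 1 := by field_simp
        _ ≤ 4 := by norm_num
    refine (norm_tiltedChar_le hMN ht hMt _).trans ?_
    rw [hsq] at h1
    have h2 : x ^ 2 * t ^ 5 / t ^ 5 = x ^ 2 := by field_simp
    rw [h2] at h1
    refine le_add_of_le_of_nonneg ?_ (by positivity)
    rw [exp_le_exp, neg_mul, neg_le_neg_iff, mul_assoc]
    gcongr
  · have h1 := le_sum_one_sub_cos_of_lt_abs ht ht1 h hx
    have hM1 : (⌊4 / t⌋₊ : ℝ) ≤ 4 / t := Nat.floor_le (by positivity)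
    have hMN : ⌊4 / t⌋₊ ≤ N := by exact_mod_cast hM1.trans hNt
    have hMt : (⌊4 / t⌋₊ : ℝ) * t ≤ 4 := by
      calc _ ≤ 4 / t * t := by gcongr
        _ = 4 := by field_simp
    refine (norm_tiltedChar_le hMN ht hMt _).trans ?_
    refine le_add_of_nonneg_of_le (exp_pos _).le ?_
    have h2 : exp (-(κ * ∑ j ∈ Finset.range ⌊4 / t⌋₊,
        (mult j : ℝ) * (1 - cos ((j + 1) * (x * (t ^ 2 * √t)))))) ≤ exp (-(κ / t)) := by
      rw [exp_le_exp, neg_le_neg_iff, div_eq_mul_one_div κ t]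
      gcongr
    refine h2.trans ?_
    have h3 : exp (-(κ / t)) ≤ 120 / κ ^ 5 * t ^ 5 := by
      have h4 := pow_div_factorial_le_exp (κ / t) (by positivity) 5
      have h5 : ((Nat.factorial 5 : ℕ) : ℝ) = 120 := by norm_num [Nat.factorial]
      rw [h5] at h4
      rw [exp_neg]
      calc (exp (κ / t))⁻¹ ≤ ((κ / t) ^ 5 / 120)⁻¹ := by gcongr
        _ = _ := by field_simp
    refine h3.trans ?_
    rw [mul_assoc]
    gcongr
    rw [← div_eq_mul_inv, le_div_iff₀ (by positivity), mul_comm, add_mul, one_mul, ← hsq]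
    have h6 : (x * (t ^ 2 * √t)) ^ 2 ≤ 4 ^ 2 := by
      rw [← sq_abs]
      gcongr
      linarith [pi_lt_four]
    have h7 : t ^ 5 ≤ 1 := pow_le_one₀ ht.le (by linarith)
    linarith

theorem exists_truncation (n : ℕ) {t : ℝ} (ht : 0 < t) : ∃ N : ℕ, n ≤ N ∧ 4 ≤ N * t ∧
    |∑ j ∈ Finset.range N, (mult j : ℝ) * log (1 + exp (-((j + 1) * t))) - logSum t| ≤ t ∧
    |∑ j ∈ Finset.range N, (mult j : ℝ) * ((j + 1) * fermi ((j + 1) * t)) - meanSum t| ≤ 1 ∧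
    |∑ j ∈ Finset.range N, (mult j : ℝ) *
      ((j + 1) ^ 2 * (fermi ((j + 1) * t) * (1 - fermi ((j + 1) * t)))) - varSum t| ≤ 1 := by
  have hev : ∀ {f : ℕ → ℝ} (_ : Summable f) {ε : ℝ} (_ : 0 < ε),
      ∀ᶠ N in atTop, |∑ j ∈ Finset.range N, f j - ∑' j, f j| ≤ ε := by
    intro f hf ε hε
    filter_upwards [Metric.tendsto_nhds.1 hf.hasSum.tendsto_sum_nat ε hε] with N hN
    exact hN.le
  have h4 : ∀ᶠ N : ℕ in atTop, 4 ≤ N * t := by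
    filter_upwards [eventually_ge_atTop ⌈4 / t⌉₊] with N hN
    rw [← div_le_iff₀ ht]
    exact (Nat.le_ceil _).trans (by exact_mod_cast hN)
  exact ((eventually_ge_atTop n).and (h4.and ((hev (summable_logSum ht) ht).and
    ((hev (summable_meanSum ht) one_pos).and (hev (summable_varSum ht) one_pos))))).exists

theorem continuous_tiltedChar (N : ℕ) (t : ℝ) : Continuous (tiltedChar N t) := by
  unfold tiltedChar bernoulliChar
  fun_prop

/-- The rescaled characteristic function of the tilted partition, recentred at `n`. -/
noncomputable def scaledChar (n N : ℕ) (t δ x : ℝ) : ℂ :=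
  (Set.Ioc (-(π / δ)) (π / δ)).indicator
    (fun x => Complex.exp (-(n * (x * δ : ℝ) * Complex.I)) * tiltedChar N t (x * δ)) x

theorem qk_eq_integral_scaledChar (n N : ℕ) (hN : n ≤ N) (t : ℝ) {δ : ℝ} (hδ : 0 < δ) :
    (2 * π : ℂ) * (qk (1 / 3) n : ℂ) =
      (exp (n * t + ∑ j ∈ Finset.range N, (mult j : ℝ) * log (1 + exp (-((j + 1) * t)))) : ℝ) *
        (δ * ∫ x, scaledChar n N t δ x) := by
  rw [qk_eq_integral_tiltedChar n N hN t]
  congr 1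
  have h1 := intervalIntegral.integral_comp_mul_right (a := -(π / δ)) (b := π / δ)
    (fun θ : ℝ => Complex.exp (-(n * θ * Complex.I)) * tiltedChar N t θ) hδ.ne'
  have h2 : -(π / δ) * δ = -π := by field_simp
  have h3 : π / δ * δ = π := by field_simp
  have hle : -(π / δ) ≤ π / δ := by
    have : 0 < π / δ := by positivity
    linarith
  rw [h2, h3, intervalIntegral.integral_of_le hle] at h1
  simp only [scaledChar]
  rw [MeasureTheory.integral_indicator measurableSet_Ioc, h1, Complex.real_smul, Complex.ofReal_inv,
    mul_inv_cancel_left₀ (by exact_mod_cast hδ.ne')]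

theorem tendsto_scaledChar {t : ℕ → ℝ} {N : ℕ → ℕ} (ht : Tendsto t atTop (𝓝[>] 0))
    (hmean : Tendsto (fun n => t n ^ 2 * √(t n) * (meanSum (t n) - n)) atTop (𝓝 0))
    (hN1 : ∀ᶠ n in atTop, |∑ j ∈ Finset.range (N n), (mult j : ℝ) *
      ((j + 1) * fermi ((j + 1) * t n)) - meanSum (t n)| ≤ 1)
    (hN2 : ∀ᶠ n in atTop, |∑ j ∈ Finset.range (N n), (mult j : ℝ) *
      ((j + 1) ^ 2 * (fermi ((j + 1) * t n) * (1 - fermi ((j + 1) * t n)))) - varSum (t n)| ≤ 1)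
    (x : ℝ) :
    Tendsto (fun n => scaledChar n (N n) (t n) (t n ^ 2 * √(t n)) x) atTop
      (𝓝 (exp (-(7 * π ^ 4 / 20) * x ^ 2) : ℝ)) := by
  obtain ⟨K, hK⟩ := exists_norm_tiltedChar_sub_le
  have hpos : ∀ᶠ n in atTop, 0 < t n := ht.eventually self_mem_nhdsWithin
  have ht0 : Tendsto t atTop (𝓝 0) := tendsto_self_nhdsGT_zero.comp ht
  have hs0 : Tendsto (fun n => √(t n)) atTop (𝓝 0) := tendsto_sqrt_nhdsGT_zero.comp ht
  set δ : ℕ → ℝ := fun n => t n ^ 2 * √(t n) with hδ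
  have hδ0 : Tendsto δ atTop (𝓝 0) := by simpa using (ht0.pow 2).mul hs0
  set μ : ℕ → ℝ := fun n => ∑ j ∈ Finset.range (N n), (mult j : ℝ) *
    ((j + 1) * fermi ((j + 1) * t n)) with hμ
  set V : ℕ → ℝ := fun n => ∑ j ∈ Finset.range (N n), (mult j : ℝ) *
    ((j + 1) ^ 2 * (fermi ((j + 1) * t n) * (1 - fermi ((j + 1) * t n)))) with hV
  have hμ0 : Tendsto (fun n => (μ n - n) * (x * δ n)) atTop (𝓝 0) := by
    have h1 : Tendsto (fun n => δ n * (μ n - meanSum (t n))) atTop (𝓝 0) :=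
      hδ0.zero_mul_isBoundedUnder_le ⟨1, by simpa using hN1⟩
    have h2 := (h1.add hmean).const_mul x
    simp only [add_zero, mul_zero] at h2
    refine h2.congr fun n => ?_
    ring
  have hV0 : Tendsto (fun n => V n * (x * δ n) ^ 2 / 2) atTop (𝓝 (7 * π ^ 4 / 20 * x ^ 2)) := by
    have h1 : Tendsto (fun n => t n ^ 5 * (V n - varSum (t n))) atTop (𝓝 0) := by
      have : Tendsto (fun n => t n ^ 5) atTop (𝓝 0) := by simpa using ht0.pow 5
      exact this.zero_mul_isBoundedUnder_le ⟨1, by simpa using hN2⟩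
    have h2 := (h1.add (tendsto_pow_mul_varSum.comp ht)).mul_const (x ^ 2 / 2)
    have h3 : (0 + 7 * π ^ 4 / 10) * (x ^ 2 / 2) = 7 * π ^ 4 / 20 * x ^ 2 := by ring
    rw [h3] at h2
    refine h2.congr' ?_
    filter_upwards [hpos] with n hn
    have h4 : (x * δ n) ^ 2 = x ^ 2 * t n ^ 5 := by
      rw [hδ]
      simp only
      rw [mul_pow, mul_pow, sq_sqrt hn.le]
      ring
    rw [h4]
    simp only [Function.comp]
    ring
  have herr : Tendsto (fun n => tiltedChar (N n) (t n) (x * δ n) *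
      Complex.exp (-((μ n : ℝ) * (x * δ n : ℝ) * Complex.I)) -
      (exp (-(V n * (x * δ n) ^ 2 / 2)) : ℝ)) atTop (𝓝 0) := by
    have h1 : Tendsto (fun n => K * (|x| ^ 3 * √(t n) + |x| ^ 4 * t n ^ 2)) atTop (𝓝 0) := by
      have := ((hs0.const_mul (|x| ^ 3)).add ((ht0.pow 2).const_mul (|x| ^ 4))).const_mul K
      simpa using this
    refine squeeze_zero_norm' ?_ h1
    filter_upwards [hpos] with n hn
    have h2 := hK (t n) hn (N n) (x * δ n)
    have hδn : 0 < δ n := by simp only [hδ]; positivity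
    have h3 : |x * δ n| ^ 3 / t n ^ 7 = |x| ^ 3 * √(t n) := by
      rw [abs_mul, abs_of_pos hδn, mul_pow]
      have : δ n ^ 3 = t n ^ 7 * √(t n) := by
        simp only [hδ]
        calc _ = t n ^ 6 * √(t n) ^ 2 * √(t n) := by ring
          _ = _ := by rw [sq_sqrt hn.le]; ring
      rw [this]
      field_simp
    have h4 : |x * δ n| ^ 4 / t n ^ 8 = |x| ^ 4 * t n ^ 2 := by
      rw [abs_mul, abs_of_pos hδn, mul_pow]
      have : δ n ^ 4 = t n ^ 10 := by
        simp only [hδ]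
        calc _ = t n ^ 8 * (√(t n) ^ 2) ^ 2 := by ring
          _ = _ := by rw [sq_sqrt hn.le]; ring
      rw [this]
      field_simp
    rwa [h3, h4] at h2
  have hgauss : Tendsto (fun n => ((exp (-(V n * (x * δ n) ^ 2 / 2)) : ℝ) : ℂ)) atTop
      (𝓝 (exp (-(7 * π ^ 4 / 20) * x ^ 2) : ℝ)) := by
    rw [neg_mul]
    exact (Complex.continuous_ofReal.tendsto _).comp ((continuous_exp.tendsto _).comp hV0.neg)
  have hphase : Tendsto (fun n => Complex.exp (((μ n - n) * (x * δ n) : ℝ) * Complex.I)) atTop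
      (𝓝 1) := by
    have h1 : Continuous fun y : ℝ => Complex.exp (y * Complex.I) := by fun_prop
    have h2 := (h1.tendsto 0).comp hμ0
    rwa [Complex.ofReal_zero, zero_mul, Complex.exp_zero] at h2
  have hfin := hphase.mul (herr.add hgauss)
  rw [zero_add, one_mul] at hfin
  refine hfin.congr' ?_
  have hsmall : ∀ᶠ n in atTop, |x| * δ n < π := by
    have h1 := hδ0.const_mul |x|
    rw [mul_zero] at h1
    exact h1.eventually_lt_const pi_pos
  filter_upwards [hpos, hsmall] with n hn hsm
  have hδn : 0 < δ n := by simp only [hδ]; positivity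
  have hx : |x| < π / δ n := by rwa [lt_div_iff₀ hδn]
  have hmem : x ∈ Set.Ioc (-(π / δ n)) (π / δ n) := ⟨(abs_lt.1 hx).1, (abs_lt.1 hx).2.le⟩
  rw [scaledChar, Set.indicator_of_mem hmem, sub_add_cancel, mul_left_comm, ← Complex.exp_add,
    mul_comm]
  congr 2
  simp only [hδ]
  push_cast
  ring

/-- The local limit theorem for the tilted partition. -/
theorem tendsto_qk_mul_exp {t : ℕ → ℝ} (ht : Tendsto t atTop (𝓝[>] 0))
    (hmean : Tendsto (fun n => t n ^ 2 * √(t n) * (meanSum (t n) - n)) atTop (𝓝 0)) :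
    Tendsto (fun n => (qk (1 / 3) n : ℝ) * exp (-(n * t n + logSum (t n))) / (t n ^ 2 * √(t n)))
      atTop (𝓝 (√(π / (7 * π ^ 4 / 20)) / (2 * π))) := by
  have hpos : ∀ᶠ n in atTop, 0 < t n := ht.eventually self_mem_nhdsWithin
  have ht0 : Tendsto t atTop (𝓝 0) := tendsto_self_nhdsGT_zero.comp ht
  have hch : ∀ n, ∃ N, 0 < t n → n ≤ N ∧ 4 ≤ N * t n ∧ _ := fun n => by
    by_cases h : 0 < t n
    · obtain ⟨N, hN⟩ := exists_truncation n h
      exact ⟨N, fun _ => hN⟩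
    · exact ⟨0, fun h' => absurd h' h⟩
  choose N hN using hch
  have hlim := fun x => tendsto_scaledChar (N := N) ht hmean
    (hpos.mono fun n hn => (hN n hn).2.2.2.1) (hpos.mono fun n hn => (hN n hn).2.2.2.2) x
  obtain ⟨c, hc, K, hK⟩ := exists_norm_tiltedChar_le
  have hint : Tendsto (fun n : ℕ => ∫ x, scaledChar n (N n) (t n) (t n ^ 2 * √(t n)) x) atTop
      (𝓝 (∫ x : ℝ, ((exp (-(7 * π ^ 4 / 20) * x ^ 2) : ℝ) : ℂ))) := by
    refine MeasureTheory.tendsto_integral_filter_of_dominated_convergence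
      (fun x => |exp (-c * x ^ 2) + K * (1 + x ^ 2)⁻¹|) ?_ ?_ ?_ (Eventually.of_forall hlim)
    · refine Eventually.of_forall fun n => ?_
      have h1 := continuous_tiltedChar (N n) (t n)
      have h2 : Continuous fun x : ℝ =>
          Complex.exp (-(n * (x * (t n ^ 2 * √(t n)) : ℝ) * Complex.I)) *
            tiltedChar (N n) (t n) (x * (t n ^ 2 * √(t n))) := by fun_prop
      exact h2.aestronglyMeasurable.indicator measurableSet_Ioc
    · filter_upwards [hpos, ht0.eventually_le_const (show (0 : ℝ) < 1 / 2 by norm_num)]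
        with n hn hn1
      refine Eventually.of_forall fun x => ?_
      have hδn : 0 < t n ^ 2 * √(t n) := by positivity
      rw [scaledChar]
      by_cases hx : x ∈ Set.Ioc (-(π / (t n ^ 2 * √(t n)))) (π / (t n ^ 2 * √(t n)))
      · have h1 : |x * (t n ^ 2 * √(t n))| ≤ π := by
          rw [abs_mul, abs_of_pos hδn, ← le_div_iff₀ hδn, abs_le]
          exact ⟨hx.1.le, hx.2⟩
        have h2 : -((n : ℂ) * (x * (t n ^ 2 * √(t n)) : ℝ) * Complex.I) =
            ((-(n * (x * (t n ^ 2 * √(t n)))) : ℝ) : ℂ) * Complex.I := by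
          push_cast
          ring
        rw [Set.indicator_of_mem hx, norm_mul, h2, Complex.norm_exp_ofReal_mul_I, one_mul]
        exact (hK (t n) hn hn1 (N n) (hN n hn).2.1 x h1).trans (le_abs_self _)
      · rw [Set.indicator_of_notMem hx, norm_zero]
        exact abs_nonneg _
    · exact ((integrable_exp_neg_mul_sq hc).add (integrable_inv_one_add_sq.const_mul K)).abs
  rw [integral_complex_ofReal, integral_gaussian] at hint
  have hexp : Tendsto (fun n => exp (∑ j ∈ Finset.range (N n), (mult j : ℝ) *
      log (1 + exp (-((j + 1) * t n))) - logSum (t n))) atTop (𝓝 1) := by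
    have h1 : Tendsto (fun n => ∑ j ∈ Finset.range (N n), (mult j : ℝ) *
        log (1 + exp (-((j + 1) * t n))) - logSum (t n)) atTop (𝓝 0) :=
      squeeze_zero_norm' (hpos.mono fun n hn => (hN n hn).2.2.1) ht0
    have h2 := (continuous_exp.tendsto _).comp h1
    rwa [exp_zero] at h2
  have hre := (hexp.mul ((Complex.continuous_re.tendsto _).comp hint)).div_const (2 * π)
  rw [Complex.ofReal_re, one_mul] at hre
  refine hre.congr' ?_
  filter_upwards [hpos] with n hn
  have hδn : 0 < t n ^ 2 * √(t n) := by positivity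
  have h1 := congrArg Complex.re (qk_eq_integral_scaledChar n (N n) (hN n hn).1 (t n) hδn)
  have h2 : (2 * π : ℂ) * (qk (1 / 3) n : ℂ) = ((2 * π * qk (1 / 3) n : ℝ) : ℂ) := by push_cast; rfl
  rw [h2, Complex.ofReal_re, Complex.re_ofReal_mul, Complex.re_ofReal_mul] at h1
  simp only [Function.comp]
  have h3 : (qk (1 / 3) n : ℝ) = 2 * π * qk (1 / 3) n / (2 * π) := by field_simp
  rw [h3, h1, exp_sub, exp_add, exp_neg, exp_add]
  generalize ∑ j ∈ Finset.range (N n), (mult j : ℝ) * log (1 + exp (-((j + 1) * t n))) = S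
  field_simp

/-! ### The saddle point -/

/-- The second-order approximation of the saddle point at `n = 7π⁴ / (40 s⁴)`. -/
noncomputable def saddle (s : ℝ) : ℝ := s * (1 + 45 * realZeta 3 / (7 * π ^ 4) * s)

theorem tendsto_saddle_factor :
    Tendsto (fun s => 1 + 45 * realZeta 3 / (7 * π ^ 4) * s) (𝓝[>] 0) (𝓝 1) := by
  have := (tendsto_self_nhdsGT_zero.const_mul (45 * realZeta 3 / (7 * π ^ 4))).const_add 1
  rwa [mul_zero, add_zero] at this

theorem tendsto_saddle : Tendsto saddle (𝓝[>] 0) (𝓝[>] 0) := by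
  refine tendsto_nhdsWithin_iff.2 ⟨?_, ?_⟩
  · have := tendsto_self_nhdsGT_zero.mul tendsto_saddle_factor
    rwa [zero_mul] at this
  · filter_upwards [self_mem_nhdsWithin, tendsto_saddle_factor.eventually_const_lt one_pos]
      with s hs hu
    exact mul_pos hs hu

theorem tendsto_meanMain_saddle_sub :
    Tendsto (fun s => saddle s ^ 2 * √(saddle s) *
      (meanMain (saddle s) - 7 * π ^ 4 / (40 * s ^ 4))) (𝓝[>] 0) (𝓝 0) := by
  set β := 45 * realZeta 3 / (7 * π ^ 4) with hβ
  have hζ : realZeta 3 = 7 * π ^ 4 / 45 * β := by rw [hβ]; field_simp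
  have hu := tendsto_saddle_factor
  rw [← hβ] at hu
  have he := tendsto_self_nhdsGT_zero.const_mul β
  have h1 := ((((he.const_mul 12).const_add 6).add ((he.pow 2).const_mul 3)).const_mul
    (-(7 * π ^ 4 / 120) * β ^ 2)).div (hu.pow 2) (by norm_num)
  have h2 := (h1.add_const (π ^ 2 / 12)).mul (tendsto_sqrt_nhdsGT_zero.comp tendsto_saddle)
  rw [mul_zero] at h2
  refine h2.congr' ?_
  filter_upwards [self_mem_nhdsWithin, hu.eventually_const_lt one_pos] with s hs hu
  have hs : 0 < s := hs
  have key : -(7 * π ^ 4 / 120) * β ^ 2 * (6 + 12 * (β * s) + 3 * (β * s) ^ 2) /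
      (1 + β * s) ^ 2 + π ^ 2 / 12 =
      saddle s ^ 2 * (meanMain (saddle s) - 7 * π ^ 4 / (40 * s ^ 4)) := by
    rw [meanMain, saddle, ← hβ, hζ]
    field_simp
    ring
  simp only [Function.comp, Pi.div_apply, key]
  ring

/-- The exponent of the asymptotic formula in terms of `s = π / (2 (5 n / 14) ^ (1 / 4))`. -/
noncomputable def exponentMain (s : ℝ) : ℝ :=
  7 * π ^ 4 / 30 * (1 / s ^ 3) + 9 * realZeta 3 / 4 * (1 / s ^ 2) +
    (π ^ 2 / 12 - 405 * realZeta 3 ^ 2 / (28 * π ^ 4)) * (1 / s) +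
    (6075 * realZeta 3 ^ 3 / (49 * π ^ 8) - 15 * realZeta 3 / (28 * π ^ 2))

theorem tendsto_logMain_saddle_sub :
    Tendsto (fun s => 7 * π ^ 4 / (40 * s ^ 4) * saddle s + logMain (saddle s) -
      exponentMain s) (𝓝[>] 0) (𝓝 (-(3 / 4 * log 2))) := by
  set β := 45 * realZeta 3 / (7 * π ^ 4) with hβ
  have hζ : realZeta 3 = 7 * π ^ 4 / 45 * β := by rw [hβ]; field_simp
  have hu := tendsto_saddle_factor
  rw [← hβ] at hu
  have he := tendsto_self_nhdsGT_zero.const_mul β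
  have h1 := ((((he.const_mul 18).const_add 9).add ((he.pow 2).const_mul 8)).const_mul
    (-(7 * π ^ 4 / 120) * β ^ 4)).div (hu.pow 3) (by norm_num)
  have h2 := (tendsto_const_nhds (x := π ^ 2 / 12 * β ^ 2)).div hu (by norm_num)
  have h3 := (tendsto_self_nhdsGT_zero.mul (h1.add h2)).add_const (-(3 / 4 * log 2))
  rw [zero_mul, zero_add] at h3
  refine h3.congr' ?_
  filter_upwards [self_mem_nhdsWithin, hu.eventually_const_lt one_pos] with s hs hu
  have hs : 0 < s := hs
  simp only [Pi.div_apply]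
  rw [logMain, exponentMain, saddle, ← hβ, hζ]
  generalize log 2 = L
  generalize hv : 1 + β * s = v at hu ⊢
  rw [← sub_eq_zero]
  field_simp
  rw [← hv]
  ring

theorem tendsto_saddle_scale :
    Tendsto (fun s => saddle s ^ 2 * √(saddle s) / (s ^ 2 * √s)) (𝓝[>] 0) (𝓝 1) := by
  have h1 := (tendsto_saddle_factor.pow 2).mul tendsto_saddle_factor.sqrt
  simp only [one_pow, sqrt_one, mul_one] at h1
  refine h1.congr' ?_
  filter_upwards [self_mem_nhdsWithin] with s hs
  have hs : 0 < s := hs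
  rw [saddle, sqrt_mul hs.le]
  field_simp

/-- The parameter `s` with `n = 7π⁴ / (40 s⁴)`. -/
noncomputable def scaleParam (n : ℕ) : ℝ := π / (2 * (5 * (n : ℝ) / 14) ^ ((1 : ℝ) / 4))

theorem tendsto_scaleParam : Tendsto scaleParam atTop (𝓝[>] 0) := by
  have h0 : Tendsto (fun n : ℕ => 5 * (n : ℝ) / 14) atTop atTop :=
    (tendsto_natCast_atTop_atTop.const_mul_atTop (by norm_num)).atTop_div_const (by norm_num)
  have h1 := ((tendsto_rpow_atTop (y := (1 : ℝ) / 4) (by norm_num)).comp h0).const_mul_atTop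
    (zero_lt_two' ℝ)
  refine tendsto_nhdsWithin_iff.2 ⟨h1.const_div_atTop π, ?_⟩
  filter_upwards [h1.eventually_gt_atTop 0] with n hn
  exact div_pos pi_pos hn

theorem qk_div_eq {n : ℕ} (hn : 0 < n) :
    (qk (1 / 3) n : ℝ) /
        ((((5 : ℝ) / 14) ^ ((1 : ℝ) / 2) *
            Real.exp (6075 * (realZeta 3) ^ 3 / (49 * π ^ 8) - 15 * realZeta 3 / (28 * π ^ 2)) /
            ((2 : ℝ) ^ ((11 : ℝ) / 4) * (5 * (n : ℝ) / 14) ^ ((5 : ℝ) / 8))) *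
          Real.exp ((28 * π / 15) * (5 * (n : ℝ) / 14) ^ ((3 : ℝ) / 4) +
            (9 * realZeta 3 / π ^ 2) * (5 * (n : ℝ) / 14) ^ ((1 : ℝ) / 2) +
            ((7 * π ^ 6 - 1215 * (realZeta 3) ^ 2) / (42 * π ^ 5)) *
              (5 * (n : ℝ) / 14) ^ ((1 : ℝ) / 4))) =
      qk (1 / 3) n * exp (-exponentMain (scaleParam n)) /
        (scaleParam n ^ 2 * √(scaleParam n)) *
        (2 ^ ((11 : ℝ) / 4) * (π ^ 2 / 4 * √(π / 2)) / √(5 / 14)) := by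
  have hx : 0 < 5 * (n : ℝ) / 14 := by positivity
  set y := (5 * (n : ℝ) / 14) ^ ((1 : ℝ) / 4) with hy
  have hy0 : 0 < y := rpow_pos_of_pos hx _
  have h3 : (5 * (n : ℝ) / 14) ^ ((3 : ℝ) / 4) = y ^ 3 := by
    rw [hy, ← rpow_mul_natCast hx.le]; norm_num
  have h2 : (5 * (n : ℝ) / 14) ^ ((1 : ℝ) / 2) = y ^ 2 := by
    rw [hy, ← rpow_mul_natCast hx.le]; norm_num
  have h5 : (5 * (n : ℝ) / 14) ^ ((5 : ℝ) / 8) = y ^ 2 * √y := by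
    rw [sqrt_eq_rpow, hy, ← rpow_mul_natCast hx.le, ← rpow_mul hx.le, ← rpow_add hx]; norm_num
  have hE : exponentMain (scaleParam n) =
      (6075 * (realZeta 3) ^ 3 / (49 * π ^ 8) - 15 * realZeta 3 / (28 * π ^ 2)) +
      ((28 * π / 15) * y ^ 3 + (9 * realZeta 3 / π ^ 2) * y ^ 2 +
        ((7 * π ^ 6 - 1215 * (realZeta 3) ^ 2) / (42 * π ^ 5)) * y) := by
    rw [exponentMain, scaleParam, ← hy]
    field_simp
    ring
  have hs : scaleParam n = π / 2 / y := by rw [scaleParam, ← hy, div_div]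
  rw [h3, h2, h5, hE, exp_neg, exp_add _ (_ + _ + _), hs, sqrt_div (by positivity : 0 ≤ π / 2),
    ← sqrt_eq_rpow]
  have h6 : 0 < √y := sqrt_pos.2 hy0
  have h7 : 0 < √(π / 2) := sqrt_pos.2 (by positivity)
  have h8 : 0 < √((5 : ℝ) / 14) := sqrt_pos.2 (by positivity)
  generalize exp (6075 * (realZeta 3) ^ 3 / (49 * π ^ 8) - 15 * realZeta 3 / (28 * π ^ 2)) = a
  generalize exp ((28 * π / 15) * y ^ 3 + (9 * realZeta 3 / π ^ 2) * y ^ 2 +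
        ((7 * π ^ 6 - 1215 * (realZeta 3) ^ 2) / (42 * π ^ 5)) * y) = b
  generalize √y = w at *
  generalize √(π / 2) = v at *
  generalize √((5 : ℝ) / 14) = z at *
  field_simp
  norm_num

theorem limit_constant :
    √(π / (7 * π ^ 4 / 20)) / (2 * π) * exp (-(3 / 4 * log 2)) *
      (2 ^ ((11 : ℝ) / 4) * (π ^ 2 / 4 * √(π / 2)) / √(5 / 14)) = 1 := by
  have h1 : (2 : ℝ) ^ ((11 : ℝ) / 4) = exp (3 / 4 * log 2) * 4 := by
    rw [show (11 : ℝ) / 4 = 3 / 4 + 2 by norm_num, rpow_add two_pos, rpow_def_of_pos two_pos,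
      mul_comm (log 2)]
    norm_num
  have h2 : √(π / (7 * π ^ 4 / 20)) * √(π / 2) = 2 / π * √(5 / 14) := by
    rw [← sqrt_mul (by positivity), ← sqrt_sq (show 0 ≤ 2 / π by positivity),
      ← sqrt_mul (by positivity)]
    congr 1
    field_simp
    norm_num
  have h3 : 0 < √((5 : ℝ) / 14) := sqrt_pos.2 (by norm_num)
  rw [h1, exp_neg]
  calc _ = √(π / (7 * π ^ 4 / 20)) * √(π / 2) * (π / 2) / √(5 / 14) := by
        field_simp
    _ = 1 := by
        rw [h2]
        field_simp

theorem stmt5 :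
    Tendsto (fun n : ℕ => (qk (1 / 3) n : ℝ) /
        ((((5 : ℝ) / 14) ^ ((1 : ℝ) / 2) *
            Real.exp (6075 * (realZeta 3) ^ 3 / (49 * π ^ 8) - 15 * realZeta 3 / (28 * π ^ 2)) /
            ((2 : ℝ) ^ ((11 : ℝ) / 4) * (5 * (n : ℝ) / 14) ^ ((5 : ℝ) / 8))) *
          Real.exp ((28 * π / 15) * (5 * (n : ℝ) / 14) ^ ((3 : ℝ) / 4) +
            (9 * realZeta 3 / π ^ 2) * (5 * (n : ℝ) / 14) ^ ((1 : ℝ) / 2) +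
            ((7 * π ^ 6 - 1215 * (realZeta 3) ^ 2) / (42 * π ^ 5)) *
              (5 * (n : ℝ) / 14) ^ ((1 : ℝ) / 4))))
      atTop (𝓝 1) := by
  have hs := tendsto_scaleParam
  have ht := tendsto_saddle.comp hs
  have hn : ∀ᶠ n : ℕ in atTop, (n : ℝ) = 7 * π ^ 4 / (40 * scaleParam n ^ 4) := by
    filter_upwards [eventually_gt_atTop 0] with n hn
    have hx : 0 < 5 * (n : ℝ) / 14 := by positivity
    have h4 : ((5 * (n : ℝ) / 14) ^ ((1 : ℝ) / 4)) ^ 4 = 5 * n / 14 := by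
      rw [← rpow_mul_natCast hx.le]; norm_num
    rw [scaleParam, div_pow, mul_pow, h4]
    field_simp
    norm_num
  have hmean : Tendsto (fun n => (saddle ∘ scaleParam) n ^ 2 * √((saddle ∘ scaleParam) n) *
      (meanSum ((saddle ∘ scaleParam) n) - n)) atTop (𝓝 0) := by
    have h := (tendsto_meanSum_sub.comp ht).add (tendsto_meanMain_saddle_sub.comp hs)
    rw [add_zero] at h
    refine h.congr' ?_
    filter_upwards [hn] with n hn
    simp only [Function.comp, ← hn]
    ring
  have hexp : Tendsto (fun n : ℕ => n * saddle (scaleParam n) + logSum (saddle (scaleParam n)) -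
      exponentMain (scaleParam n)) atTop (𝓝 (-(3 / 4 * log 2))) := by
    have h := (tendsto_logSum_sub.comp ht).add (tendsto_logMain_saddle_sub.comp hs)
    rw [zero_add] at h
    refine h.congr' ?_
    filter_upwards [hn] with n hn
    simp only [Function.comp, ← hn]
    ring
  have h := (((tendsto_qk_mul_exp ht hmean).mul ((continuous_exp.tendsto _).comp hexp)).mul
    (tendsto_saddle_scale.comp hs)).mul_const
      (2 ^ ((11 : ℝ) / 4) * (π ^ 2 / 4 * √(π / 2)) / √(5 / 14))
  rw [mul_one, limit_constant] at h
  refine h.congr' ?_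
  filter_upwards [eventually_gt_atTop 0, hs.eventually self_mem_nhdsWithin,
    ht.eventually self_mem_nhdsWithin] with n hn hs ht
  rw [qk_div_eq hn]
  simp only [Function.comp] at ht ⊢
  have ht : 0 < saddle (scaleParam n) := ht
  have hs : 0 < scaleParam n := hs
  congr 1
  rw [exp_sub, exp_neg, exp_neg]
  field_simp
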